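/- arXiv:2503.02290 — 10 statements merged into one kernel-verified Lean document; each statement's English description precedes it below -/
import Mathlib

section
/- Let I be an ideal on ω such that ED ≤_K I. Then either fin×fin ≤_K I, or there exists X ∈ I⁺ such that ED_fin ≤_K I↾X. -/
open Cardinal Set

/-- An ideal on a (countably infinite) set: contains finite sets, not the whole set,
closed under subsets and finite unions. -/
def IsIdeal {α : Type*} (I : Set (Set α)) : Prop :=
  (∀ A : Set α, A.Finite → A ∈ I) ∧ (Set.univ ∉ I) ∧
    (∀ A B : Set α, A ∈ I → B ⊆ A → B ∈ I) ∧
    (∀ A B : Set α, A ∈ I → B ∈ I → A ∪ B ∈ I)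

/-- `J ≤_K I`: there is a function from the underlying set of `I` to that of `J`
pulling members of `J` back into `I`. -/
def KatetovLE {α β : Type*} (J : Set (Set β)) (I : Set (Set α)) : Prop :=
  ∃ f : α → β, ∀ A ∈ J, f ⁻¹' A ∈ I

def FiniteToOne {α β : Type*} (f : α → β) : Prop := ∀ b : β, (f ⁻¹' {b}).Finite

/-- `J ≤_KB I`: Katětov-Blass order (finite-to-one witness). -/
def KatetovBlassLE {α β : Type*} (J : Set (Set β)) (I : Set (Set α)) : Prop :=
  ∃ f : α → β, FiniteToOne f ∧ ∀ A ∈ J, f ⁻¹' A ∈ I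

/-- The restriction `I ↾ X`, as an ideal on the subtype `X`. -/
def restrictIdeal {α : Type*} (I : Set (Set α)) (X : Set α) : Set (Set ↥X) :=
  {A : Set ↥X | (Subtype.val '' A) ∈ I}

/-- The ideal generated by a family `G` together with the finite sets. -/
def genIdeal {α : Type*} (G : Set (Set α)) : Set (Set α) :=
  {A | ∃ (S : Finset (Set α)) (F : Set α), ↑S ⊆ G ∧ F.Finite ∧ A ⊆ F ∪ ⋃₀ ↑S}

/-- Generators of the eventually different ideal: columns and graphs of functions. -/
def EDGenerators : Set (Set (ℕ × ℕ)) :=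
  {C | ∃ n : ℕ, C = {p : ℕ × ℕ | p.1 = n}} ∪
    {G | ∃ f : ℕ → ℕ, G = {p : ℕ × ℕ | p.2 = f p.1}}

/-- The eventually different ideal on `ω × ω`. -/
def ED : Set (Set (ℕ × ℕ)) := genIdeal EDGenerators

/-- Generators of `fin × fin`: columns and regions under graphs. -/
def FinFinGenerators : Set (Set (ℕ × ℕ)) :=
  {C | ∃ n : ℕ, C = {p : ℕ × ℕ | p.1 = n}} ∪
    {D | ∃ f : ℕ → ℕ, D = {p : ℕ × ℕ | p.2 ≤ f p.1}}

/-- The ideal `fin × fin` on `ω × ω`. -/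
def FinTimesFin : Set (Set (ℕ × ℕ)) := genIdeal FinFinGenerators

def Delta : Set (ℕ × ℕ) := {p : ℕ × ℕ | p.2 ≤ p.1}

/-- `ED_fin`, the restriction of `ED` to `Δ = {(n,m) : m ≤ n}`. -/
def EDfin : Set (Set ↥Delta) := restrictIdeal ED Delta

/-- The ideal of nowhere dense subsets of the rationals. -/
def nwdQ : Set (Set ℚ) := {A : Set ℚ | IsNowhereDense A}

/-- The copy of a family of subsets of `α` inside the Cantor space `α → Bool`
(via characteristic functions). -/
def cantorCopy {α : Type*} (I : Set (Set α)) : Set (α → Bool) :=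
  {x : α → Bool | {a : α | x a = true} ∈ I}

def IsUltrafilterSet (U : Set (Set ℕ)) : Prop :=
  Set.univ ∈ U ∧ ∅ ∉ U ∧ (∀ A B : Set ℕ, A ∈ U → A ⊆ B → B ∈ U) ∧
    (∀ A B : Set ℕ, A ∈ U → B ∈ U → A ∩ B ∈ U) ∧
    (∀ A : Set ℕ, A ∈ U ∨ (Set.univ \ A) ∈ U)

def NonprincipalUF (U : Set (Set ℕ)) : Prop := ∀ A : Set ℕ, A.Finite → A ∉ U

/-- The dual ideal `U*` of an ultrafilter `U`. -/
def dualIdeal (U : Set (Set ℕ)) : Set (Set ℕ) := {A : Set ℕ | Set.univ \ A ∈ U}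

/-- `U` is a Ramsey ultrafilter. -/
def IsRamseyUF (U : Set (Set ℕ)) : Prop :=
  ∀ P : ℕ → Set ℕ, Pairwise (Function.onFun Disjoint P) → (⋃ n, P n) = Set.univ →
    (∀ n, P n ∉ U) → ∃ A ∈ U, ∀ n, (A ∩ P n).Subsingleton

def IsTight (I : Set (Set ℕ)) : Prop :=
  ∀ X : ℕ → Set ℕ, (∀ n, X n ∉ I) → ∃ Y ∈ I, ∀ n, (Y ∩ X n).Infinite

def IsPIdeal (I : Set (Set ℕ)) : Prop :=
  ∀ A : ℕ → Set ℕ, (∀ n, A n ∈ I) → ∃ B ∈ I, ∀ n, (A n \ B).Finite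

def IsPMinus (I : Set (Set ℕ)) : Prop :=
  ∀ X : Set ℕ, X ∉ I → ∀ Xs : ℕ → Set ℕ, (∀ n, Xs n ⊆ X) → (∀ n, X \ Xs n ∈ I) →
    ∃ Y : Set ℕ, Y ∉ I ∧ ∀ n, (Y \ Xs n).Finite

def IsQPlus (I : Set (Set ℕ)) : Prop :=
  ∀ X : Set ℕ, X ∉ I → ∀ P : ℕ → Set ℕ, (∀ n, (P n).Finite) →
    Pairwise (Function.onFun Disjoint P) → (⋃ n, P n) = X →
    ∃ A : Set ℕ, A ∉ I ∧ A ⊆ X ∧ ∀ n, (A ∩ P n).Subsingleton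

def AlmostSubset (A B : Set ℕ) : Prop := (A \ B).Finite

/-- The tower number 𝔱. -/
noncomputable def towerNumber : Cardinal :=
  sInf {c : Cardinal | ∃ T : Set (Set ℕ),
    (∀ A ∈ T, A.Infinite) ∧
    (∀ A ∈ T, ∀ B ∈ T, AlmostSubset A B ∨ AlmostSubset B A) ∧
    (¬ ∃ A : Set ℕ, A.Infinite ∧ ∀ B ∈ T, AlmostSubset A B) ∧
    Cardinal.mk T = c}

/-- cov(M): covering number of the meager ideal of Baire space. -/
noncomputable def covM : Cardinal :=
  sInf {c : Cardinal | ∃ F : Set (Set (ℕ → ℕ)),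
    (∀ A ∈ F, IsMeagre A) ∧ ⋃₀ F = Set.univ ∧ Cardinal.mk F = c}

/-- The dominating number 𝔡. -/
noncomputable def dNumber : Cardinal :=
  sInf {c : Cardinal | ∃ D : Set (ℕ → ℕ),
    (∀ f : ℕ → ℕ, ∃ g ∈ D, ∀ᶠ n in Filter.atTop, f n ≤ g n) ∧ Cardinal.mk D = c}

/-- The cofinality of an ideal: least size of a cofinal subfamily. -/
noncomputable def idealCof (I : Set (Set ℕ)) : Cardinal :=
  sInf {c : Cardinal | ∃ C : Set (Set ℕ), C ⊆ I ∧ (∀ A ∈ I, ∃ B ∈ C, A ⊆ B) ∧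
    Cardinal.mk C = c}

/-- An increasing interval partition of ω, given by its sequence of endpoints. -/
structure IncIntervalPartition where
  e : ℕ → ℕ
  zero : e 0 = 0
  mono : StrictMono e
  incr : ∀ n : ℕ, e (n + 1) - e n < e (n + 2) - e (n + 1)

def IncIntervalPartition.block (P : IncIntervalPartition) (n : ℕ) : Set ℕ :=
  Set.Ico (P.e n) (P.e (n + 1))

/-- A selector of an interval partition: a set meeting each block in exactly one point. -/
def IsSelector (P : IncIntervalPartition) (S : Set ℕ) : Prop :=
  ∀ n : ℕ, ∃! x : ℕ, x ∈ S ∩ P.block n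

/-- The ideal `ED_P` generated by the selectors of `P` (and the finite sets). -/
def EDP (P : IncIntervalPartition) : Set (Set ℕ) := genIdeal {S : Set ℕ | IsSelector P S}

/-- A Fréchet space: closure points are limits of sequences. -/
def IsFrechet (α : Type*) [TopologicalSpace α] : Prop :=
  ∀ (a : α) (Y : Set α), a ∈ closure Y →
    ∃ u : ℕ → α, (∀ n, u n ∈ Y) ∧ Filter.Tendsto u Filter.atTop (nhds a)

/-- Zero-dimensional: the clopen sets form a basis. -/
def ZeroDimensional (α : Type*) [TopologicalSpace α] : Prop :=
  TopologicalSpace.IsTopologicalBasis {U : Set α | IsClopen U}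

/-- A local π-base at a point. -/
def IsLocalPiBase {α : Type*} [TopologicalSpace α] (B : Set (Set α)) (b : α) : Prop :=
  (∀ U ∈ B, IsOpen U ∧ U.Nonempty) ∧
    ∀ V : Set α, IsOpen V → b ∈ V → ∃ U ∈ B, U ⊆ V

/-- Every point has uncountable π-character. -/
def UncountablePiCharEverywhere (α : Type*) [TopologicalSpace α] : Prop :=
  ∀ (b : α) (B : Set (Set α)), IsLocalPiBase B b → ¬ B.Countable

/-- An independent family on ω. -/
def IsIndepFamily (B : Set (Set ℕ)) : Prop :=
  (∀ A ∈ B, A.Infinite) ∧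
    ∀ F G : Finset (Set ℕ), ↑F ⊆ B → ↑G ⊆ B → Disjoint F G →
      ((⋂ A ∈ F, A) ∩ ⋂ A ∈ G, (Set.univ \ A)).Infinite

def SeparatesPointsFam (B : Set (Set ℕ)) : Prop :=
  ∀ m n : ℕ, m ≠ n → ∃ A ∈ B, m ∈ A ∧ n ∉ A

/-- The envelope of an independent family: finite Boolean combinations. -/
def envSets (B : Set (Set ℕ)) : Set (Set ℕ) :=
  {V : Set ℕ | ∃ F G : Finset (Set ℕ), ↑F ⊆ B ∧ ↑G ⊆ B ∧ Disjoint F G ∧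
    V = (⋂ A ∈ F, A) ∩ ⋂ A ∈ G, (Set.univ \ A)}

/-- The topology on ω generated by the envelope of `B`. -/
def XBtop (B : Set (Set ℕ)) : TopologicalSpace ℕ :=
  TopologicalSpace.generateFrom (envSets B)

/-- The ideal of nowhere dense subsets of the space `X(B)`. -/
def nwdXB (B : Set (Set ℕ)) : Set (Set ℕ) :=
  {A : Set ℕ | @IsNowhereDense ℕ (XBtop B) A}

/-- `non*(ED_fin)`. -/
noncomputable def nonStarEDfin : Cardinal :=
  sInf {c : Cardinal | ∃ H : Set (Set ↥Delta),
    (∀ A ∈ H, A.Infinite) ∧ (∀ A ∈ EDfin, ∃ B ∈ H, (A ∩ B).Finite) ∧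
    Cardinal.mk H = c}

/-- The sets whose preimage lies in an ideal include everything generated by such sets. -/
theorem preimage_mem_of_mem_genIdeal {α β : Type*} {I : Set (Set α)} (hI : IsIdeal I)
    {G : Set (Set β)} {f : α → β} (hG : ∀ C ∈ G, f ⁻¹' C ∈ I)
    (hpt : ∀ b, f ⁻¹' {b} ∈ I) {A : Set β} (hA : A ∈ genIdeal G) : f ⁻¹' A ∈ I := by
  obtain ⟨hfin, -, hsub, hun⟩ := hI
  obtain ⟨S, F, hS, hF, hA⟩ := hA
  have hempty : (∅ : Set α) ∈ I := hfin _ Set.finite_empty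
  have hFI : f ⁻¹' F ∈ I := by
    clear hA
    induction F, hF using Set.Finite.induction_on_subset with
    | empty => simpa using hempty
    | insert _ _ _ ih =>
      rw [Set.insert_eq, Set.preimage_union]
      exact hun _ _ (hpt _) ih
  have hSI : f ⁻¹' (⋃₀ (S : Set (Set β))) ∈ I := by
    clear hA
    classical
    induction S using Finset.induction_on with
    | empty => simpa using hempty
    | insert C S _ ih =>
      rw [Finset.coe_insert, Set.insert_subset_iff] at hS
      rw [Finset.coe_insert, Set.sUnion_insert, Set.preimage_union]
      exact hun _ _ (hG _ hS.1) (ih hS.2)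
  exact hsub _ _ (hun _ _ hFI hSI) (Set.preimage_mono hA)

theorem mem_genIdeal_of_mem {α : Type*} {G : Set (Set α)} {C : Set α} (hC : C ∈ G) :
    C ∈ genIdeal G :=
  ⟨{C}, ∅, by simpa using hC, Set.finite_empty, by simp⟩

theorem column_mem_ED (n : ℕ) : {p : ℕ × ℕ | p.1 = n} ∈ ED :=
  mem_genIdeal_of_mem (Or.inl ⟨n, rfl⟩)

theorem graph_mem_ED (g : ℕ → ℕ) : {p : ℕ × ℕ | p.2 = g p.1} ∈ ED :=
  mem_genIdeal_of_mem (Or.inr ⟨g, rfl⟩)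

theorem exists_strictMono_ge (g : ℕ → ℕ) : ∃ G : ℕ → ℕ, StrictMono G ∧ ∀ n, g n ≤ G n := by
  refine ⟨fun n => n + ∑ k ∈ Finset.range (n + 1), g k, strictMono_nat_of_lt_succ fun n => ?_,
    fun n => ?_⟩
  · rw [Finset.sum_range_succ _ (n + 1)]
    omega
  · simp only [Finset.sum_range_succ]
    omega

/-- Relabelling the columns of `ω × ω` injectively preserves Katětov reductions of `ED`. -/
theorem preimage_relabel_mem {I : Set (Set ℕ)} (hI : IsIdeal I) {f : ℕ → ℕ × ℕ}
    (hf : ∀ A ∈ ED, f ⁻¹' A ∈ I) {G : ℕ → ℕ} (hG : Function.Injective G)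
    {A : Set (ℕ × ℕ)} (hA : A ∈ ED) : (fun x => (G (f x).1, (f x).2)) ⁻¹' A ∈ I := by
  have hcol : ∀ n, {x | G (f x).1 = n} ∈ I := by
    intro n
    by_cases hn : ∃ k, G k = n
    · obtain ⟨k, rfl⟩ := hn
      exact hI.2.2.1 _ _ (hf _ (column_mem_ED k)) fun x hx => hG hx
    · exact hI.2.2.1 _ _ (hI.1 ∅ Set.finite_empty) fun x hx => hn ⟨_, hx⟩
  refine preimage_mem_of_mem_genIdeal hI ?_ (fun b => ?_) hA
  · rintro C (⟨n, rfl⟩ | ⟨h, rfl⟩)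
    · exact hcol n
    · exact hf _ (graph_mem_ED (h ∘ G))
  · exact hI.2.2.1 _ _ (hcol b.1) fun x hx => congrArg Prod.fst hx

/-- if `ED ≤_K I` then either `fin×fin ≤_K I` or some positive `X`
has `ED_fin ≤_K I↾X`. -/
theorem stmt0 (I : Set (Set ℕ)) (hI : IsIdeal I) (hED : KatetovLE ED I) :
    KatetovLE FinTimesFin I ∨
      ∃ X : Set ℕ, X ∉ I ∧ KatetovLE EDfin (restrictIdeal I X) := by
  obtain ⟨f, hf⟩ := hED
  by_cases hreg : ∀ g : ℕ → ℕ, f ⁻¹' {p | p.2 ≤ g p.1} ∈ I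
  · refine Or.inl ⟨f, fun A hA => preimage_mem_of_mem_genIdeal hI ?_ (fun b => ?_) hA⟩
    · rintro C (⟨n, rfl⟩ | ⟨g, rfl⟩)
      · exact hf _ (column_mem_ED n)
      · exact hreg g
    · exact hI.2.2.1 _ _ (hf _ (column_mem_ED b.1)) fun x hx => congrArg Prod.fst hx
  · obtain ⟨g, hg⟩ := not_forall.mp hreg
    obtain ⟨G, hmono, hle⟩ := exists_strictMono_ge g
    refine Or.inr ⟨_, hg, fun x => ⟨(G (f x).1, (f x).2), le_trans x.2 (hle _)⟩, fun A hA => ?_⟩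
    refine hI.2.2.1 _ _ (preimage_relabel_mem hI hf hmono.injective hA) ?_
    rintro _ ⟨x, hx, rfl⟩
    exact ⟨_, hx, rfl⟩
end

section
/- For any two increasing interval partitions P and R of ω, the ideals ED_P and ED_R are isomorphic: there is a bijection f : ω → ω such that for every A ⊆ ω, A ∈ ED_R if and only if f⁻¹(A) ∈ ED_P. -/
open Cardinal Set

namespace IncIntervalPartition

/-- The index of the block containing a point. -/
def index (P : IncIntervalPartition) (x : ℕ) : ℕ := Nat.findGreatest (fun n => P.e n ≤ x) x

theorem mem_block_index (P : IncIntervalPartition) (x : ℕ) : x ∈ P.block (P.index x) := by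
  have h0 : P.e 0 ≤ x := by simp [P.zero]
  refine ⟨Nat.findGreatest_spec (P := fun n => P.e n ≤ x) (Nat.zero_le x) h0, ?_⟩
  by_contra! hle
  have hx : P.index x + 1 ≤ x := (P.mono.id_le _).trans hle
  exact Nat.findGreatest_is_greatest (P := fun n => P.e n ≤ x) (Nat.lt_succ_self _) hx hle

theorem mem_block_iff (P : IncIntervalPartition) {x n : ℕ} : x ∈ P.block n ↔ P.index x = n := by
  refine ⟨fun h => ?_, fun h => h ▸ P.mem_block_index x⟩
  have h' := P.mem_block_index x
  have h1 := P.mono.lt_iff_lt.1 (h.1.trans_lt h'.2)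
  have h2 := P.mono.lt_iff_lt.1 (h'.1.trans_lt h.2)
  omega

theorem le_blockSize (P : IncIntervalPartition) (n : ℕ) : n + 1 ≤ P.e (n + 1) - P.e n := by
  induction n with
  | zero =>
    have := P.mono (show 0 < 0 + 1 by omega)
    omega
  | succ n ih => exact (Nat.succ_le_succ ih).trans (P.incr n)

/-- Any partition embeds into any other one, with blocks mapped into distinct blocks. -/
theorem exists_embedding (P R : IncIntervalPartition) :
    ∃ (f σ : ℕ → ℕ), Function.Injective f ∧ Function.Injective σ ∧
      ∀ x, R.index (f x) = σ (P.index x) := by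
  have hσ : Function.Injective fun i => P.e (i + 1) :=
    fun a b hab => Nat.succ_injective (P.mono.injective hab)
  have hidx : ∀ x, R.index (R.e (P.e (P.index x + 1)) + x) = P.e (P.index x + 1) := by
    intro x
    have hx := (P.mem_block_index x).2
    have hsize := R.le_blockSize (P.e (P.index x + 1))
    rw [← mem_block_iff]
    exact ⟨Nat.le_add_right _ _, by omega⟩
  refine ⟨fun x => R.e (P.e (P.index x + 1)) + x, fun i => P.e (i + 1), ?_, hσ, hidx⟩
  intro x y hxy
  have h : P.e (P.index x + 1) = P.e (P.index y + 1) := by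
    rw [← hidx x, ← hidx y]
    exact congrArg R.index hxy
  simp only [h] at hxy
  omega

end IncIntervalPartition

theorem genIdeal_of_subset {α : Type*} {G : Set (Set α)} {A B : Set α} (hA : A ∈ genIdeal G)
    (hBA : B ⊆ A) : B ∈ genIdeal G := by
  obtain ⟨S, F, hS, hF, h⟩ := hA
  exact ⟨S, F, hS, hF, hBA.trans h⟩

theorem genIdeal_of_finite {α : Type*} {G : Set (Set α)} {A : Set α} (hA : A.Finite) :
    A ∈ genIdeal G :=
  ⟨∅, A, by simp, hA, by simp⟩

theorem genIdeal_union {α : Type*} {G : Set (Set α)} {A B : Set α} (hA : A ∈ genIdeal G)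
    (hB : B ∈ genIdeal G) : A ∪ B ∈ genIdeal G := by
  classical
  obtain ⟨S, F, hS, hF, h⟩ := hA
  obtain ⟨T, E, hT, hE, h'⟩ := hB
  refine ⟨S ∪ T, F ∪ E, by simp [hS, hT], hF.union hE, ?_⟩
  rw [Finset.coe_union, sUnion_union]
  rintro x (hx | hx)
  · rcases h hx with hx | hx
    · exact Or.inl (Or.inl hx)
    · exact Or.inr (Or.inl hx)
  · rcases h' hx with hx | hx
    · exact Or.inl (Or.inr hx)
    · exact Or.inr (Or.inr hx)

theorem genIdeal_biUnion {α β : Type*} {G : Set (Set α)} (S : Finset β) (A : β → Set α)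
    (hA : ∀ s ∈ S, A s ∈ genIdeal G) : (⋃ s ∈ S, A s) ∈ genIdeal G := by
  classical
  induction S using Finset.induction_on with
  | empty => exact genIdeal_of_finite (by simp)
  | insert a S _ ih =>
    rw [Finset.set_biUnion_insert]
    exact genIdeal_union (hA a (Finset.mem_insert_self a S))
      (ih fun s hs => hA s (Finset.mem_insert_of_mem hs))

theorem IsSelector.injOn_index {P : IncIntervalPartition} {S : Set ℕ} (hS : IsSelector P S) :
    InjOn P.index S := fun x hx y hy hxy =>
  (hS (P.index x)).unique ⟨hx, P.mem_block_index x⟩ ⟨hy, hxy ▸ P.mem_block_index y⟩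

theorem mem_EDP_of_injOn_index {P : IncIntervalPartition} {A : Set ℕ} (hA : InjOn P.index A) :
    A ∈ EDP P := by
  have hsel : IsSelector P (A ∪ {x | x = P.e (P.index x) ∧ P.index x ∉ P.index '' A}) := by
    intro n
    by_cases hn : n ∈ P.index '' A
    · obtain ⟨a, ha, rfl⟩ := hn
      refine ⟨a, ⟨Or.inl ha, P.mem_block_index a⟩, ?_⟩
      rintro y ⟨hy | hy, hyn⟩
      · exact hA hy ha (P.mem_block_iff.1 hyn)
      · exact absurd ⟨a, ha, (P.mem_block_iff.1 hyn).symm⟩ hy.2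
    · have hidx : P.index (P.e n) = n :=
        P.mem_block_iff.1 ⟨le_rfl, P.mono (Nat.lt_succ_self n)⟩
      refine ⟨P.e n, ⟨Or.inr ⟨by rw [hidx], by rwa [hidx]⟩,
        P.mem_block_iff.2 hidx⟩, ?_⟩
      rintro y ⟨hy | hy, hyn⟩
      · exact absurd ⟨y, hy, P.mem_block_iff.1 hyn⟩ hn
      · rw [hy.1, P.mem_block_iff.1 hyn]
  exact ⟨{_}, ∅, by simpa using hsel, finite_empty, by simp⟩

theorem preimage_mem_EDP {P R : IncIntervalPartition} {f g σ τ h : ℕ → ℕ}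
    (hf : Function.Injective f) (hfσ : ∀ x, R.index (f x) = σ (P.index x))
    (hτ : Function.Injective τ) (hgτ : ∀ y, P.index (g y) = τ (R.index y))
    (hh : Function.Injective h) (hfg : ∀ x, h x = f x ∨ x = g (h x)) {A : Set ℕ}
    (hA : A ∈ EDP R) : h ⁻¹' A ∈ EDP P := by
  obtain ⟨S, F, hS, hF, hAS⟩ := hA
  have hsel : ∀ s ∈ S, h ⁻¹' s ∈ EDP P := by
    intro s hs
    have hinj : InjOn R.index s := IsSelector.injOn_index (hS hs)
    have h1 : f ⁻¹' s ∈ EDP P := mem_EDP_of_injOn_index fun x hx y hy hxy =>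
      hf (hinj hx hy (by rw [hfσ, hfσ, hxy]))
    have h2 : g '' s ∈ EDP P := by
      apply mem_EDP_of_injOn_index
      rintro _ ⟨x, hx, rfl⟩ _ ⟨y, hy, rfl⟩ hxy
      rw [hgτ, hgτ] at hxy
      rw [hinj hx hy (hτ hxy)]
    refine genIdeal_of_subset (genIdeal_union h1 h2) fun x hx => ?_
    rcases hfg x with hx' | hx'
    · exact Or.inl (by rw [mem_preimage, ← hx']; exact hx)
    · exact Or.inr ⟨h x, hx, hx'.symm⟩
  refine genIdeal_of_subset
    (genIdeal_union (genIdeal_of_finite (hF.preimage hh.injOn)) (genIdeal_biUnion S _ hsel))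
    fun x hx => ?_
  rcases hAS hx with hx | ⟨s, hs, hx⟩
  · exact Or.inl hx
  · exact Or.inr (mem_biUnion (t := fun s => h ⁻¹' s) hs hx)

/-- any two ideals `ED_P`, `ED_R` for increasing interval partitions
are isomorphic. -/
theorem stmt1 (P R : IncIntervalPartition) :
    ∃ f : ℕ → ℕ, Function.Bijective f ∧
      ∀ A : Set ℕ, A ∈ EDP R ↔ f ⁻¹' A ∈ EDP P := by
  obtain ⟨f, σ, hf, hσ, hfσ⟩ := P.exists_embedding R
  obtain ⟨g, τ, hg, hτ, hgτ⟩ := R.exists_embedding P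
  obtain ⟨h, hh, hfg⟩ := Function.Embedding.schroeder_bernstein_of_rel hf hg
    (fun x y => y = f x ∨ x = g y) (fun _ => Or.inl rfl) (fun _ => Or.inr rfl)
  obtain ⟨k, hkh, hhk⟩ := Function.bijective_iff_has_inverse.1 hh
  refine ⟨h, hh, fun A => ⟨preimage_mem_EDP hf hfσ hτ hgτ hh.injective hfg, fun hA => ?_⟩⟩
  have hA' : k ⁻¹' (h ⁻¹' A) ∈ EDP R := by
    refine preimage_mem_EDP hg hgτ hσ hfσ hhk.injective (fun y => ?_) hA
    have := hfg (k y)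
    rw [hhk y] at this
    exact this.symm
  rwa [← preimage_comp, hhk.comp_eq_id, preimage_id] at hA'
end

section
/- Let I and J be ideals on ω. If I is an analytic subset of P(ω) and J ≤_K I, then J is a meager subset of P(ω). -/
open Cardinal Set

/-- The points at every neighbourhood of which `s` is nonmeagre. -/
def nonmeagreLocus {X : Type*} [TopologicalSpace X] (s : Set X) : Set X :=
  (⋃₀ {V | IsOpen V ∧ IsMeagre (s ∩ V)})ᶜ

section NonmeagreLocus

variable {X : Type*} [TopologicalSpace X]

theorem isClosed_nonmeagreLocus (s : Set X) : IsClosed (nonmeagreLocus s) :=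
  (isOpen_sUnion fun _ hV => hV.1).isClosed_compl

theorem disjoint_nonmeagreLocus {s V : Set X} (hV : IsOpen V) (h : IsMeagre (s ∩ V)) :
    Disjoint V (nonmeagreLocus s) :=
  disjoint_left.2 fun _ hx hx' => hx' ⟨V, ⟨hV, h⟩, hx⟩

theorem nonmeagreLocus_subset_closure (s : Set X) : nonmeagreLocus s ⊆ closure s := by
  intro x hx
  by_contra hxs
  refine disjoint_left.1 (disjoint_nonmeagreLocus (s := s) isClosed_closure.isOpen_compl ?_) hxs hx
  rw [(disjoint_compl_right.mono_left subset_closure).inter_eq]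
  exact IsMeagre.empty

theorem isMeagre_diff_nonmeagreLocus [SecondCountableTopology X] (s : Set X) :
    IsMeagre (s \ nonmeagreLocus s) := by
  obtain ⟨T, hTc, hTS, hT⟩ := TopologicalSpace.isOpen_sUnion_countable
    {V : Set X | IsOpen V ∧ IsMeagre (s ∩ V)} fun _ hV => hV.1
  rw [nonmeagreLocus, sdiff_compl, ← hT, sUnion_eq_biUnion, inter_iUnion₂]
  exact isMeagre_biUnion hTc fun V hV => (hTS hV).2

theorem BaireMeasurableSet.isMeagre_or_exists_isOpen {s : Set X} (hs : BaireMeasurableSet s) :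
    IsMeagre s ∨ ∃ u, IsOpen u ∧ u.Nonempty ∧ IsMeagre (u \ s) := by
  obtain ⟨u, hu, hsu⟩ := hs.residualEq_isOpen
  rcases u.eq_empty_or_nonempty with rfl | hne
  · left
    filter_upwards [Filter.eventuallyEq_set.1 hsu] with x hx
    simpa using hx
  · refine .inr ⟨u, hu, hne, ?_⟩
    filter_upwards [Filter.eventuallyEq_set.1 hsu] with x hx
    simp [hx]

theorem isMeagre_nonmeagreLocus_diff_iUnion [SecondCountableTopology X] {ι : Type*} [Countable ι]
    {s : Set X} {t : ι → Set X} (hst : s ⊆ ⋃ i, t i) :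
    IsMeagre (nonmeagreLocus s \ ⋃ i, nonmeagreLocus (t i)) := by
  have hmeas (r : Set X) : BaireMeasurableSet (nonmeagreLocus r) :=
    .of_compl (isClosed_nonmeagreLocus r).isOpen_compl.baireMeasurableSet
  set m := nonmeagreLocus s \ ⋃ i, nonmeagreLocus (t i) with hm
  obtain ⟨u, hu, hmu⟩ := ((hmeas s).diff (.iUnion fun i => hmeas (t i))).residualEq_isOpen
  rw [← hm] at hmu
  have hum : IsMeagre (u \ m) := by
    filter_upwards [Filter.eventuallyEq_set.1 hmu] with x hx
    simp [hx]
  have hmu' : IsMeagre (m \ u) := by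
    filter_upwards [Filter.eventuallyEq_set.1 hmu] with x hx
    simp [hx]
  have hsu : IsMeagre (s ∩ u) := by
    refine (hum.union (isMeagre_iUnion fun i => isMeagre_diff_nonmeagreLocus (t i))).mono ?_
    rintro x ⟨hxs, hxu⟩
    obtain ⟨i, hi⟩ := mem_iUnion.1 (hst hxs)
    by_cases hxi : x ∈ nonmeagreLocus (t i)
    · exact .inl ⟨hxu, fun hxm => hxm.2 (mem_iUnion.2 ⟨i, hxi⟩)⟩
    · exact .inr (mem_iUnion.2 ⟨i, hi, hxi⟩)
  refine hmu'.mono ?_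
  intro x hx
  refine ⟨hx, fun hxu => ?_⟩
  exact disjoint_left.1 (disjoint_nonmeagreLocus hu hsu) hxu hx.1

end NonmeagreLocus

/-- The sequences whose first entries are those of `l`, in reverse order. -/
def reverseCylinder : List ℕ → Set (ℕ → ℕ)
  | [] => univ
  | k :: l => reverseCylinder l ∩ {x | x l.length = k}

/-- Analytic sets have the Baire property. -/
theorem MeasureTheory.AnalyticSet.baireMeasurableSet {X : Type*} [TopologicalSpace X] [T2Space X]
    [SecondCountableTopology X] {s : Set X} (hs : MeasureTheory.AnalyticSet s) :
    BaireMeasurableSet s := by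
  rw [MeasureTheory.AnalyticSet] at hs
  obtain rfl | ⟨g, hg, rfl⟩ := hs
  · exact isOpen_empty.baireMeasurableSet
  let A (l : List ℕ) : Set X := g '' reverseCylinder l
  have hA (l : List ℕ) : A l ⊆ ⋃ k, A (k :: l) := by
    rintro _ ⟨x, hx, rfl⟩
    exact mem_iUnion.2 ⟨x l.length, x, ⟨hx, rfl⟩, rfl⟩
  have hA0 : A [] = range g := image_univ
  have hdiff : IsMeagre (nonmeagreLocus (range g) \ range g) := by
    refine (isMeagre_iUnion fun l => isMeagre_nonmeagreLocus_diff_iUnion (hA l)).mono ?_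
    rintro x ⟨hx, hxg⟩
    by_contra hxM
    have hstep (l : List ℕ) (hl : x ∈ nonmeagreLocus (A l)) :
        ∃ k, x ∈ nonmeagreLocus (A (k :: l)) := by
      by_contra hk
      exact hxM (mem_iUnion.2 ⟨l, hl, fun h => hk (mem_iUnion.1 h)⟩)
    choose! k hk using hstep
    let p (n : ℕ) : List ℕ := Nat.rec [] (fun _ l => k l :: l) n
    have hp (n : ℕ) : x ∈ nonmeagreLocus (A (p n)) := by
      induction n with
      | zero => exact hA0 ▸ hx
      | succ n ih => exact hk _ ih
    have hlen (n : ℕ) : (p n).length = n := by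
      induction n with
      | zero => rfl
      | succ n ih => exact congrArg (· + 1) ih
    let σ (n : ℕ) : ℕ := k (p n)
    have hcyl (n : ℕ) : reverseCylinder (p n) ⊆ PiNat.cylinder σ n := by
      induction n with
      | zero => simp
      | succ n ih =>
        rintro y ⟨hy, hyn⟩ i hi
        obtain hi | rfl := Nat.lt_succ_iff_lt_or_eq.1 hi
        · exact ih hy i hi
        · exact (congrArg y (hlen i)).symm.trans hyn
    have hne : x ≠ g σ := fun h => hxg ⟨σ, h.symm⟩
    obtain ⟨U, W, hU, hW, hxU, hσW, hUW⟩ := t2_separation hne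
    obtain ⟨_, ⟨z, n, rfl⟩, hσz, hzW⟩ :=
      (PiNat.isTopologicalBasis_cylinders (fun _ : ℕ => ℕ)).exists_subset_of_mem_open
        (show σ ∈ g ⁻¹' W from hσW) (hW.preimage hg)
    rw [← PiNat.mem_cylinder_iff_eq.1 hσz] at hzW
    obtain ⟨_, hyU, y, hy, rfl⟩ :=
      mem_closure_iff.1 (nonmeagreLocus_subset_closure _ (hp n)) U hU hxU
    exact disjoint_left.1 hUW hyU (hzW (hcyl n hy))
  have hloc : BaireMeasurableSet (nonmeagreLocus (range g)) :=
    .of_compl (isClosed_nonmeagreLocus _).isOpen_compl.baireMeasurableSet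
  have heq : range g = nonmeagreLocus (range g) \ (nonmeagreLocus (range g) \ range g) ∪
      range g \ nonmeagreLocus (range g) := by
    ext x
    simp only [mem_union, mem_sdiff]
    tauto
  rw [heq]
  exact (hloc.diff hdiff.baireMeasurableSet).union
    (isMeagre_diff_nonmeagreLocus _).baireMeasurableSet

/-- The involution of the Cantor space flipping all coordinates from `n` on. -/
def flipFrom (n : ℕ) (x : ℕ → Bool) : ℕ → Bool := fun i => if i < n then x i else !x i

theorem flipFrom_flipFrom (n : ℕ) (x : ℕ → Bool) : flipFrom n (flipFrom n x) = x := by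
  ext i
  by_cases h : i < n <;> simp [flipFrom, h]

theorem continuous_flipFrom (n : ℕ) : Continuous (flipFrom n) := by
  refine continuous_pi fun i => ?_
  by_cases h : i < n
  · simpa [flipFrom, h] using continuous_apply i
  · simpa [flipFrom, h, Function.comp_def] using
      (continuous_of_discreteTopology (f := Bool.not)).comp (continuous_apply i)

theorem isOpenMap_flipFrom (n : ℕ) : IsOpenMap (flipFrom n) :=
  IsOpenMap.of_inverse (continuous_flipFrom n) (flipFrom_flipFrom n) (flipFrom_flipFrom n)

/-- An ideal on `ℕ` with the Baire property is meagre. -/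
theorem IsIdeal.isMeagre_cantorCopy {K : Set (Set ℕ)} (hK : IsIdeal K)
    (hB : BaireMeasurableSet (cantorCopy K)) : IsMeagre (cantorCopy K) := by
  obtain ⟨hfin, huniv, -, hunion⟩ := hK
  refine hB.isMeagre_or_exists_isOpen.resolve_right ?_
  rintro ⟨u, hu, ⟨a, ha⟩, hdiff⟩
  obtain ⟨_, ⟨z, n, rfl⟩, haz, hzu⟩ :=
    (PiNat.isTopologicalBasis_cylinders (fun _ : ℕ => Bool)).exists_subset_of_mem_open ha hu
  have hflip := hdiff.preimage_of_isOpenMap (continuous_flipFrom n) (isOpenMap_flipFrom n)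
  obtain ⟨y, hyz, hy⟩ := (dense_of_mem_residual (hdiff.union hflip)).inter_open_nonempty _
    (PiNat.isOpen_cylinder (fun _ : ℕ => Bool) z n) ⟨a, haz⟩
  have hyz' : flipFrom n y ∈ PiNat.cylinder z n := fun i hi => by
    simpa [flipFrom, hi] using hyz i hi
  have hyK : y ∈ cantorCopy K := by_contra fun h => hy (.inl ⟨hzu hyz, h⟩)
  have hyK' : flipFrom n y ∈ cantorCopy K := by_contra fun h => hy (.inr ⟨hzu hyz', h⟩)
  apply huniv
  convert hunion _ _ (hfin _ (finite_Iio n)) (hunion _ _ hyK hyK')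
  ext i
  by_cases hi : i < n <;> cases h : y i <;> simp [flipFrom, hi, h]

theorem IsIdeal.preimage {α β : Type*} {I : Set (Set α)} (hI : IsIdeal I) {f : α → β}
    (hf : ∀ A : Set β, A.Finite → f ⁻¹' A ∈ I) : IsIdeal {A : Set β | f ⁻¹' A ∈ I} :=
  ⟨hf, hI.2.1, fun _ _ hA hBA => hI.2.2.1 _ _ hA (preimage_mono hBA),
    fun _ _ hA hB => hI.2.2.2 _ _ hA hB⟩

/-- if `I` is analytic and `J ≤_K I`, then `J` is meager. -/
theorem stmt2 (I J : Set (Set ℕ)) (hI : IsIdeal I) (hJ : IsIdeal J)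
    (hIan : MeasureTheory.AnalyticSet (cantorCopy I)) (hK : KatetovLE J I) :
    IsMeagre (cantorCopy J) := by
  obtain ⟨f, hf⟩ := hK
  have hcont : Continuous fun (x : ℕ → Bool) (a : ℕ) => x (f a) :=
    continuous_pi fun a => continuous_apply (f a)
  have : PolishSpace (ℕ → Bool) :=
    { toSecondCountableTopology := inferInstance
      toIsCompletelyMetrizableSpace := inferInstance }
  have han : MeasureTheory.AnalyticSet (cantorCopy {A : Set ℕ | f ⁻¹' A ∈ I}) :=
    hIan.preimage hcont
  exact ((hI.preimage fun A hA => hf A (hJ.1 A hA)).isMeagre_cantorCopy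
    han.baireMeasurableSet).mono fun x hx => hf _ hx
end

section
/- The dominating number 𝔡 equals the least value of cof(J) over all ideals J on ω that are not P⁻-ideals. -/
open Cardinal Set

/-- A family cofinal in an ideal that is not `P⁻` yields a dominating family of at most the same
size. -/
theorem dNumber_le_mk_of_cofinal {J : Set (Set ℕ)} (hJ : IsIdeal J) (hP : ¬ IsPMinus J)
    {C : Set (Set ℕ)} (hC : C ⊆ J) (hcof : ∀ A ∈ J, ∃ B ∈ C, A ⊆ B) :
    dNumber ≤ Cardinal.mk C := by
  obtain ⟨hfin, -, hsub, hunion⟩ := hJ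
  unfold IsPMinus at hP
  push Not at hP
  obtain ⟨X, hX, Xs, -, hXs, hY⟩ := hP
  have hF : ∀ n, {x ∈ X | ∃ i ≤ n, x ∉ Xs i} ∈ J := by
    intro n
    induction n with
    | zero =>
      refine hsub _ _ (hXs 0) ?_
      rintro x ⟨hx, i, hi, hxi⟩
      obtain rfl : i = 0 := by omega
      exact ⟨hx, hxi⟩
    | succ n ih =>
      refine hsub _ _ (hunion _ _ ih (hXs (n + 1))) ?_
      rintro x ⟨hx, i, hi, hxi⟩
      rcases Nat.le_succ_iff.mp hi with hi | rfl
      · exact Or.inl ⟨hx, i, hi, hxi⟩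
      · exact Or.inr ⟨hx, hxi⟩
  have hg : ∀ B : C, ∀ n, ∃ x ∈ X, (∀ i ≤ n, x ∈ Xs i) ∧ x ∉ (B : Set ℕ) := by
    intro B n
    by_contra! h
    refine hX (hsub _ _ (hunion _ _ (hF n) (hC B.2)) fun x hx => ?_)
    by_cases hxi : ∀ i ≤ n, x ∈ Xs i
    · exact Or.inr (h x hx hxi)
    · push Not at hxi
      exact Or.inl ⟨hx, hxi⟩
  choose g hgX hgXs hgB using hg
  have hdom : ∀ f : ℕ → ℕ, ∃ h ∈ range g, ∀ᶠ n in Filter.atTop, f n ≤ h n := by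
    intro f
    have hYf : {x ∈ X | ∃ n, (∀ i ≤ n, x ∈ Xs i) ∧ x ≤ f n} ∈ J := by
      by_contra hn
      obtain ⟨m, hm⟩ := hY _ hn
      refine hm ((Set.finite_Iic ((Finset.range m).sup f)).subset ?_)
      rintro x ⟨⟨-, n, hn, hxn⟩, hxm⟩
      have hnm : n < m := by
        by_contra! h
        exact hxm (hn m h)
      exact hxn.trans (Finset.le_sup (f := f) (Finset.mem_range.mpr hnm))
    obtain ⟨B, hB, hYB⟩ := hcof _ hYf
    refine ⟨g ⟨B, hB⟩, mem_range_self _, Filter.Eventually.of_forall fun n => ?_⟩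
    by_contra! h
    exact hgB ⟨B, hB⟩ n (hYB ⟨hgX _ n, n, hgXs _ n, h.le⟩)
  refine le_trans (csInf_le' ?_) (Cardinal.mk_range_le (f := g))
  exact ⟨_, hdom, rfl⟩

theorem dNumber_le_idealCof {J : Set (Set ℕ)} (hJ : IsIdeal J) (hP : ¬ IsPMinus J) :
    dNumber ≤ idealCof J := by
  refine le_csInf ⟨_, J, subset_rfl, fun A hA => ⟨A, hA, subset_rfl⟩, rfl⟩ ?_
  rintro _ ⟨C, hC, hcof, rfl⟩
  exact dNumber_le_mk_of_cofinal hJ hP hC hcof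

/-- The code of the union of the first `n` columns and the region under the graph of `f`. -/
def underGraph (n : ℕ) (f : ℕ → ℕ) : Set ℕ :=
  {x | x.unpair.1 < n ∨ x.unpair.2 ≤ f x.unpair.1}

/-- The ideal `fin × fin` transported to `ℕ` along the pairing function. -/
def finFinNat : Set (Set ℕ) := {A | ∃ n f, A ⊆ underGraph n f}

theorem isIdeal_finFinNat : IsIdeal finFinNat := by
  refine ⟨fun A hA => ?_, ?_, ?_, ?_⟩
  · obtain ⟨N, hN⟩ := hA.bddAbove
    exact ⟨N + 1, 0, fun x hx => Or.inl
      (Nat.lt_succ_of_le ((Nat.unpair_left_le x).trans (hN hx)))⟩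
  · rintro ⟨n, f, h⟩
    have := h (mem_univ (Nat.pair n (f n + 1)))
    simp [underGraph] at this
  · rintro A B ⟨n, f, h⟩ hBA
    exact ⟨n, f, hBA.trans h⟩
  · rintro A B ⟨n, f, hA⟩ ⟨m, g, hB⟩
    refine ⟨max n m, fun k => max (f k) (g k), ?_⟩
    rintro x (hx | hx)
    · exact (hA hx).imp (fun h => lt_max_of_lt_left h) fun h => le_max_of_le_left h
    · exact (hB hx).imp (fun h => lt_max_of_lt_right h) fun h => le_max_of_le_right h

theorem not_isPMinus_finFinNat : ¬ IsPMinus finFinNat := by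
  intro h
  obtain ⟨Y, hY, hfin⟩ := h univ isIdeal_finFinNat.2.1 (fun n => {x | n ≤ x.unpair.1})
    (fun n => subset_univ _)
    (fun n => ⟨n, 0, fun x hx => Or.inl (not_le.mp hx.2)⟩)
  choose f hf using fun n => (hfin (n + 1)).bddAbove
  refine hY ⟨0, f, fun x hx => Or.inr ?_⟩
  exact (Nat.unpair_right_le x).trans (hf x.unpair.1 ⟨hx, by simp⟩)

theorem infinite_of_dominating {D : Set (ℕ → ℕ)}
    (hD : ∀ f : ℕ → ℕ, ∃ g ∈ D, ∀ᶠ n in Filter.atTop, f n ≤ g n) : D.Infinite := by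
  intro hfin
  obtain ⟨g, hg, hle⟩ := hD fun n => hfin.toFinset.sup (fun g => g n) + 1
  obtain ⟨n, hn⟩ := hle.exists
  have := Finset.le_sup (f := fun g : ℕ → ℕ => g n) (hfin.mem_toFinset.mpr hg)
  exact absurd hn (Nat.not_le.mpr (Nat.lt_succ_of_le this))

theorem idealCof_finFinNat_le : idealCof finFinNat ≤ dNumber := by
  refine le_csInf ⟨_, univ, fun f => ⟨f, mem_univ f, by simp⟩, rfl⟩ ?_
  rintro _ ⟨D, hD, rfl⟩
  have : Infinite D := (infinite_of_dominating hD).to_subtype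
  have hle : Cardinal.mk (range fun p : ℕ × D => underGraph p.1 p.2) ≤ Cardinal.mk D :=
    Cardinal.mk_range_le.trans (by simp)
  refine le_trans (csInf_le' ?_) hle
  refine ⟨_, ?_, ?_, rfl⟩
  · rintro _ ⟨p, rfl⟩
    exact ⟨p.1, p.2, subset_rfl⟩
  · rintro A ⟨n, f, hA⟩
    obtain ⟨g, hg, hle⟩ := hD f
    obtain ⟨m, hm⟩ := Filter.eventually_atTop.mp hle
    refine ⟨_, ⟨(max n m, ⟨g, hg⟩), rfl⟩, fun x hx => ?_⟩
    rcases hA hx with h | h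
    · exact Or.inl (lt_max_of_lt_left h)
    · rcases lt_or_ge x.unpair.1 m with hxm | hxm
      · exact Or.inl (lt_max_of_lt_right hxm)
      · exact Or.inr (h.trans (hm _ hxm))

/-- 𝔡 is the least cofinality of an ideal on ω that is not P⁻. -/
theorem stmt3 :
    dNumber = sInf {c : Cardinal |
      ∃ J : Set (Set ℕ), IsIdeal J ∧ ¬ IsPMinus J ∧ idealCof J = c} := by
  apply le_antisymm
  · refine le_csInf ⟨_, _, isIdeal_finFinNat, not_isPMinus_finFinNat, rfl⟩ ?_
    rintro _ ⟨J, hJ, hP, rfl⟩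
    exact dNumber_le_idealCof hJ hP
  · refine le_trans (csInf_le' ?_) idealCof_finFinNat_le
    exact ⟨_, isIdeal_finFinNat, not_isPMinus_finFinNat, rfl⟩
end

section
/- The following are equivalent: (1) for every nonprincipal ultrafilter U on ω, the dual ideal U* either satisfies U* ≤_K nwd or there exists X ∈ (U*)⁺ with ED ≤_K U*↾X; (2) there is no Ramsey ultrafilter on ω. -/
open Cardinal Set

/-- Countably many infinite sets of naturals are simultaneously split by a single set. -/
lemma exists_splitting_set {S : ℕ → Set ℕ} (hS : ∀ n, (S n).Infinite) :
    ∃ A : Set ℕ, ∀ n, (S n ∩ A).Nonempty ∧ (S n ∩ Aᶜ).Nonempty := by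
  obtain ⟨t, ht, htS⟩ := Filter.extraction_forall_of_frequently
    (fun n => Nat.frequently_atTop_iff_infinite.2 (hS (n / 2)))
  refine ⟨Set.range fun n => t (2 * n), fun n => ⟨⟨t (2 * n), ?_, n, rfl⟩, t (2 * n + 1), ?_, ?_⟩⟩
  · have h := htS (2 * n)
    rwa [show 2 * n / 2 = n by omega] at h
  · have h := htS (2 * n + 1)
    rwa [show (2 * n + 1) / 2 = n by omega] at h
  · rintro ⟨m, hm⟩
    have := ht.injective hm
    omega

/-- A dense subset of a nonempty space is not nowhere dense. -/
lemma not_isNowhereDense_of_dense {α : Type*} [TopologicalSpace α] [Nonempty α] {A : Set α}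
    (hA : Dense A) : ¬ IsNowhereDense A := by
  intro h
  rw [IsNowhereDense, hA.closure_eq, interior_univ] at h
  exact Set.empty_ne_univ h.symm

lemma univ_diff_mem_dualIdeal {U : Set (Set ℕ)} {A : Set ℕ} (hA : A ∈ U) :
    Set.univ \ A ∈ dualIdeal U := by
  simpa [dualIdeal] using hA

lemma mem_dualIdeal_of_notMem {U : Set (Set ℕ)} (hU : IsUltrafilterSet U) {A : Set ℕ}
    (hA : A ∉ U) : A ∈ dualIdeal U :=
  (hU.2.2.2.2 A).resolve_left hA

lemma notMem_of_mem_dualIdeal {U : Set (Set ℕ)} (hU : IsUltrafilterSet U) {A : Set ℕ}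
    (hA : A ∈ dualIdeal U) : A ∉ U := fun h => by
  have := hU.2.2.2.1 _ _ h hA
  exact hU.2.1 (by simpa using this)

lemma dualIdeal_mono {U : Set (Set ℕ)} (hU : IsUltrafilterSet U) {A B : Set ℕ}
    (hA : A ∈ dualIdeal U) (hBA : B ⊆ A) : B ∈ dualIdeal U :=
  hU.2.2.1 _ _ hA (Set.sdiff_subset_sdiff_right hBA)

lemma dualIdeal_union {U : Set (Set ℕ)} (hU : IsUltrafilterSet U) {A B : Set ℕ}
    (hA : A ∈ dualIdeal U) (hB : B ∈ dualIdeal U) : A ∪ B ∈ dualIdeal U := by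
  have := hU.2.2.2.1 _ _ hA hB
  rwa [Set.sdiff_inter_sdiff] at this

lemma dualIdeal_biUnion {U : Set (Set ℕ)} (hU : IsUltrafilterSet U) {ι : Type*} (S : Finset ι)
    (g : ι → Set ℕ) (h : ∀ i ∈ S, g i ∈ dualIdeal U) : (⋃ i ∈ S, g i) ∈ dualIdeal U := by
  classical
  induction S using Finset.induction_on with
  | empty => simpa [dualIdeal] using hU.1
  | insert a S _ ih =>
    rw [Finset.set_biUnion_insert]
    exact dualIdeal_union hU (h a (Finset.mem_insert_self a S))
      (ih fun i hi => h i (Finset.mem_insert_of_mem hi))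

/-- The dual ideal of a nonprincipal ultrafilter is never Katětov below `nwd`. -/
lemma not_katetovLE_dualIdeal_nwdQ {U : Set (Set ℕ)} (hU : IsUltrafilterSet U)
    (hn : NonprincipalUF U) : ¬ KatetovLE (dualIdeal U) nwdQ := by
  rintro ⟨f, hf⟩
  obtain ⟨b, hbc, hbe, hb⟩ := TopologicalSpace.exists_countable_basis ℚ
  have hbne : b.Nonempty := by
    obtain ⟨v, hv, -⟩ := hb.exists_subset_of_mem_open (Set.mem_univ (0 : ℚ)) isOpen_univ
    exact ⟨v, hv⟩
  obtain ⟨V, rfl⟩ := hbc.exists_eq_range hbne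
  have hV : ∀ n, (f '' V n).Infinite := by
    intro n hfin
    have hnwd : IsNowhereDense (f ⁻¹' (f '' V n)) :=
      hf _ (mem_dualIdeal_of_notMem hU (hn _ hfin))
    have hsub : V n ⊆ interior (closure (f ⁻¹' (f '' V n))) :=
      interior_maximal ((Set.subset_preimage_image f (V n)).trans subset_closure)
        (hb.isOpen ⟨n, rfl⟩)
    rw [hnwd] at hsub
    exact hbe ⟨n, Set.subset_empty_iff.1 hsub⟩
  obtain ⟨A, hA⟩ := exists_splitting_set hV
  have key : ∀ B : Set ℕ, (∀ n, (f '' V n ∩ B).Nonempty) → B ∉ dualIdeal U := by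
    intro B hB hBU
    refine not_isNowhereDense_of_dense (hb.dense_iff.2 ?_) (hf B hBU)
    rintro _ ⟨n, rfl⟩ -
    obtain ⟨_, ⟨q, hq, rfl⟩, hqB⟩ := hB n
    exact ⟨q, hq, hqB⟩
  rcases hU.2.2.2.2 A with h | h
  · refine key Aᶜ (fun n => (hA n).2) ?_
    rw [Set.compl_eq_univ_sdiff]
    exact univ_diff_mem_dualIdeal h
  · exact key A (fun n => (hA n).1) h

lemma mem_ED_of_mem_EDGenerators {A : Set (ℕ × ℕ)} (hA : A ∈ EDGenerators) : A ∈ ED :=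
  ⟨{A}, ∅, by simpa using hA, Set.finite_empty, by simp⟩

/-- For a Ramsey ultrafilter `U`, no restriction of `U*` to a set of `U` is Katětov above `ED`. -/
lemma IsRamseyUF.not_katetovLE_ED {U : Set (Set ℕ)} (hU : IsUltrafilterSet U)
    (hR : IsRamseyUF U) {X : Set ℕ} (hX : X ∉ dualIdeal U) :
    ¬ KatetovLE ED (restrictIdeal (dualIdeal U) X) := by
  classical
  rintro ⟨f, hf⟩
  have hXU : X ∈ U := by
    by_contra h
    exact hX (mem_dualIdeal_of_notMem hU h)
  let c : ℕ → ℕ := fun k => if h : k ∈ X then (f ⟨k, h⟩).1 + 1 else 0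
  have hc : ∀ n, c ⁻¹' {n} ∉ U := by
    intro n
    apply notMem_of_mem_dualIdeal hU
    cases n with
    | zero =>
      refine dualIdeal_mono hU (univ_diff_mem_dualIdeal hXU) fun k hk => ⟨trivial, fun h => ?_⟩
      simp [c, h] at hk
    | succ n =>
      refine dualIdeal_mono hU (hf _ (mem_ED_of_mem_EDGenerators (Or.inl ⟨n, rfl⟩))) fun k hk => ?_
      by_cases h : k ∈ X
      · exact ⟨⟨k, h⟩, by simpa [c, h] using hk, rfl⟩
      · simp [c, h] at hk
  obtain ⟨A, hAU, hA⟩ := hR (fun n => c ⁻¹' {n})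
    (fun m n hmn => Set.disjoint_left.2 fun k hm hk => hmn (hm.symm.trans hk))
    (Set.eq_univ_of_forall fun k => Set.mem_iUnion.2 ⟨c k, rfl⟩) hc
  have hcol : ∀ n, ∃ m, ∀ k (h : k ∈ X), k ∈ A → (f ⟨k, h⟩).1 = n → (f ⟨k, h⟩).2 = m := by
    intro n
    by_cases hex : ∃ k, ∃ h : k ∈ X, k ∈ A ∧ (f ⟨k, h⟩).1 = n
    · obtain ⟨k, h, hkA, hkn⟩ := hex
      refine ⟨(f ⟨k, h⟩).2, fun l hl hlA hln => ?_⟩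
      obtain rfl : l = k := hA (n + 1) ⟨hlA, by simp [c, hl, hln]⟩ ⟨hkA, by simp [c, h, hkn]⟩
      rfl
    · exact ⟨0, fun k h hkA hkn => (hex ⟨k, h, hkA, hkn⟩).elim⟩
  choose g hg using hcol
  refine notMem_of_mem_dualIdeal hU (dualIdeal_mono hU
    (hf _ (mem_ED_of_mem_EDGenerators (Or.inr ⟨g, rfl⟩))) ?_) (hU.2.2.2.1 A X hAU hXU)
  rintro k ⟨hkA, hkX⟩
  exact ⟨⟨k, hkX⟩, hg _ k hkX hkA rfl, rfl⟩

/-- If `U` is not Ramsey then `ED` is Katětov below `U*`. -/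
lemma exists_map_preimage_ED_mem_dualIdeal {U : Set (Set ℕ)} (hU : IsUltrafilterSet U)
    (hn : NonprincipalUF U) (hR : ¬ IsRamseyUF U) :
    ∃ f : ℕ → ℕ × ℕ, ∀ A ∈ ED, f ⁻¹' A ∈ dualIdeal U := by
  unfold IsRamseyUF at hR
  push Not at hR
  obtain ⟨P, hPd, hPu, hPU, hsel⟩ := hR
  have hex : ∀ k, ∃ n, k ∈ P n := fun k => Set.mem_iUnion.1 (hPu ▸ Set.mem_univ k)
  choose c hc using hex
  have huniq : ∀ {k n}, k ∈ P n → c k = n := fun {k n} hk => by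
    by_contra h
    exact Set.disjoint_left.1 (hPd h) (hc k) hk
  refine ⟨fun k => (c k, k), ?_⟩
  rintro A ⟨S, F, hS, hF, hA⟩
  have hinj : Function.Injective fun k => (c k, k) := fun a b h => (Prod.ext_iff.1 h).2
  have hgen : ∀ G ∈ S, (fun k => (c k, k)) ⁻¹' G ∈ dualIdeal U := by
    intro G hG
    apply mem_dualIdeal_of_notMem hU
    rcases hS hG with ⟨n, rfl⟩ | ⟨g, rfl⟩
    · exact fun h => hPU n (hU.2.2.1 _ _ h fun k (hk : c k = n) => hk ▸ hc k)
    · intro h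
      obtain ⟨n, hns⟩ := hsel _ h
      refine Set.not_subsingleton_iff.2 hns ?_
      rintro a ⟨ha, haP⟩ b ⟨hb, hbP⟩
      change a = g (c a) at ha
      change b = g (c b) at hb
      rw [ha, hb, huniq haP, huniq hbP]
  refine dualIdeal_mono hU (dualIdeal_union hU
    (mem_dualIdeal_of_notMem hU (hn _ (hF.preimage hinj.injOn)))
    (dualIdeal_biUnion hU S _ hgen)) fun k hk => ?_
  rcases hA hk with h | ⟨G, hG, hkG⟩
  · exact Or.inl h
  · exact Or.inr (Set.mem_biUnion (Finset.mem_coe.1 hG) hkG)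

/-- the Category Dichotomy for maximal ideals is equivalent to the
nonexistence of Ramsey ultrafilters. -/
theorem stmt4 :
    (∀ U : Set (Set ℕ), IsUltrafilterSet U → NonprincipalUF U →
        (KatetovLE (dualIdeal U) nwdQ ∨
          ∃ X : Set ℕ, X ∉ dualIdeal U ∧ KatetovLE ED (restrictIdeal (dualIdeal U) X)))
      ↔ ¬ ∃ U : Set (Set ℕ), IsUltrafilterSet U ∧ NonprincipalUF U ∧ IsRamseyUF U := by
  constructor
  · rintro h ⟨U, hU, hn, hR⟩
    rcases h U hU hn with h | ⟨X, hX, h⟩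
    · exact not_katetovLE_dualIdeal_nwdQ hU hn h
    · exact hR.not_katetovLE_ED hU hX h
  · intro h U hU hn
    obtain ⟨f, hf⟩ := exists_map_preimage_ED_mem_dualIdeal hU hn fun hR => h ⟨U, hU, hn, hR⟩
    refine Or.inr ⟨Set.univ, fun hm => notMem_of_mem_dualIdeal hU hm hU.1, fun k => f k,
      fun A hA => dualIdeal_mono hU (hf A hA) ?_⟩
    rintro _ ⟨k, hk, rfl⟩
    exact hk
end

section
/- If I is a tight ideal on ω, then I is not Katětov below nwd, i.e., I ≰_K nwd. -/
open Cardinal Set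

theorem IsOpen.eq_empty_of_isNowhereDense {α : Type*} [TopologicalSpace α] {U A : Set α}
    (hU : IsOpen U) (hUA : U ⊆ A) (hA : IsNowhereDense A) : U = ∅ :=
  subset_empty_iff.1 (hA ▸ interior_maximal (hUA.trans subset_closure) hU)

/-- a tight ideal is not Katětov below `nwd`. -/
theorem stmt5 (I : Set (Set ℕ)) (hI : IsIdeal I) (ht : IsTight I) :
    ¬ KatetovLE I nwdQ := by
  rintro ⟨f, hf⟩
  obtain ⟨b, hbc, hb_empty, hb⟩ := TopologicalSpace.exists_countable_basis ℚ
  have hbne : b.Nonempty := by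
    obtain ⟨v, hv, -⟩ := hb.exists_subset_of_mem_open (mem_univ (0 : ℚ)) isOpen_univ
    exact ⟨v, hv⟩
  obtain ⟨U, rfl⟩ := hbc.exists_eq_range hbne
  have hpos (n : ℕ) : f '' U n ∉ I := fun h =>
    hb_empty ⟨n, (hb.isOpen (mem_range_self n)).eq_empty_of_isNowhereDense
      (subset_preimage_image f (U n)) (hf _ h)⟩
  obtain ⟨Y, hYI, hY⟩ := ht _ hpos
  have hdense : Dense (f ⁻¹' Y) := hb.dense_iff.2 <| by
    rintro _ ⟨n, rfl⟩ -
    obtain ⟨_, hxY, q, hqU, rfl⟩ := (hY n).nonempty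
    exact ⟨q, hqU, hxY⟩
  have hnwd : interior (closure (f ⁻¹' Y)) = ∅ := hf Y hYI
  simp [hdense.closure_eq] at hnwd
end

section
/- Assume the Filter Dichotomy: for every ideal I on ω, either I is a meager subset of P(ω), or there is a nonprincipal ultrafilter U on ω and a finite-to-one function f : ω → ω such that for every A ⊆ ω, A ∈ U* if and only if f⁻¹(A) ∈ I. Then every non-meager ideal I on ω satisfies ED_fin ≤_KB I. -/
open Cardinal Set

/-- `S` is a filter base of the ultrafilter `U`. -/
def IsUltrafilterBase {α : Type*} (S : Set (Set α)) (U : Ultrafilter α) : Prop :=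
  S ⊆ {A | A ∈ U} ∧ ∀ A ∈ U, ∃ B ∈ S, B ⊆ A

/-- A nonprincipal ultrafilter on `ℕ` is not countably generated. -/
theorem not_isCountablyGenerated_of_le_cofinite (U : Ultrafilter ℕ)
    (hU : (U : Filter ℕ) ≤ Filter.cofinite) : ¬ (U : Filter ℕ).IsCountablyGenerated := by
  intro _
  obtain ⟨x, hx⟩ := Filter.exists_seq_tendsto (U : Filter ℕ)
  obtain ⟨φ, hφ, hxφ⟩ := Filter.strictMono_subseq_of_tendsto_atTop
    (Nat.cofinite_eq_atTop ▸ hx.mono_right hU)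
  have ht : Filter.Tendsto (x ∘ φ) Filter.atTop U := hx.comp hφ.tendsto_atTop
  set E : Set ℕ := Set.range fun n => (x ∘ φ) (2 * n)
  rcases U.mem_or_compl_mem E with h | h
  · obtain ⟨N, hN⟩ := Filter.eventually_atTop.1 (ht h)
    obtain ⟨m, hm⟩ := hN (2 * N + 1) (by omega)
    have := hxφ.injective hm
    omega
  · obtain ⟨N, hN⟩ := Filter.eventually_atTop.1 (ht h)
    exact hN (2 * N) (by omega) ⟨N, rfl⟩

/-- A nonprincipal ultrafilter on `ℕ` has no countable base. -/
theorem IsUltrafilterBase.aleph0_lt {S : Set (Set ℕ)} {U : Ultrafilter ℕ}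
    (hS : IsUltrafilterBase S U) (hU : (U : Filter ℕ) ≤ Filter.cofinite) :
    ℵ₀ < Cardinal.mk S := by
  by_contra! h
  have : Countable S := Cardinal.mk_le_aleph0_iff.1 h
  refine not_isCountablyGenerated_of_le_cofinite U hU ?_
  refine Filter.HasBasis.isCountablyGenerated (ι := S) (p := fun _ => True)
    (s := fun B => (B : Set ℕ)) ⟨fun A => ⟨fun hA => ?_, ?_⟩⟩
  · obtain ⟨B, hB, hBA⟩ := hS.2 A hA
    exact ⟨⟨B, hB⟩, trivial, hBA⟩
  · rintro ⟨B, -, hBA⟩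
    exact Filter.mem_of_superset (hS.1 B.2) hBA

/-- If the image of a filter generated by an infinite family `T` is contained in an ultrafilter,
then the ultrafilter has a base of size at most that of `T`. -/
theorem exists_base_of_map_generate_le {T : Set (Set ℕ)} (hT : T.Infinite) (U : Ultrafilter ℕ)
    (g : ℕ → ℕ) [(Filter.generate T).NeBot] (h : (Filter.generate T).map g ≤ U) :
    ∃ S, IsUltrafilterBase S U ∧ Cardinal.mk S ≤ Cardinal.mk T := by
  have heq : (Filter.generate T).map g = U := U.unique h
  have hb := (Filter.hasBasis_generate T).map g
  rw [heq] at hb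
  have := hT.to_subtype
  let F : Finset T → Set ℕ := fun t => g '' ⋂₀ (Subtype.val '' (t : Set T))
  have hF : ∀ t : Finset T, ((Subtype.val '' (t : Set T)).Finite ∧ Subtype.val '' (t : Set T) ⊆ T) :=
    fun t => ⟨t.finite_toSet.image _, by rintro _ ⟨x, -, rfl⟩; exact x.2⟩
  refine ⟨Set.range F, ⟨?_, fun A hA => ?_⟩, ?_⟩
  · rintro _ ⟨t, rfl⟩
    exact hb.mem_of_mem (hF t)
  · obtain ⟨t, ⟨htf, htT⟩, htA⟩ := hb.mem_iff.1 hA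
    refine ⟨_, ⟨(htf.preimage Subtype.val_injective.injOn).toFinset, rfl⟩, ?_⟩
    have : Subtype.val '' (Subtype.val ⁻¹' t : Set T) = t := by simpa using htT
    simpa only [F, Set.Finite.coe_toFinset, this] using htA
  · exact Cardinal.mk_range_le.trans (Cardinal.mk_finset_of_infinite T).le

/-- Values of a function on a well-order can be prescribed in terms of the set of earlier values. -/
theorem exists_forall_image_Iio {ι β : Type*} [LinearOrder ι] [WellFoundedLT ι]
    {P : ι → Set β → β → Prop} (hP : ∀ i T, ∃ b, P i T b) :
    ∃ Y : ι → β, ∀ i, P i (Y '' Iio i) (Y i) := by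
  choose step hstep using hP
  let F : ∀ i : ι, (∀ j, j < i → β) → β := fun i rec => step i {b | ∃ j, ∃ h : j < i, rec j h = b}
  refine ⟨wellFounded_lt.fix F, fun i => ?_⟩
  have : wellFounded_lt.fix F i = step i (wellFounded_lt.fix F '' Iio i) := by
    rw [WellFounded.fix_eq]
    simp [F, Set.image]
  rw [this]
  exact hstep i _

/-- An increasing union of families indexed by a linear order generates a proper filter as soon as
each of the families does. -/
theorem generate_image_union_neBot {ι α : Type*} [LinearOrder ι] {Y : ι → Set α} {C : Set (Set α)}
    (hC : (Filter.generate C).NeBot) {s : Set ι} (hs : ∀ i ∈ s, ∀ j ≤ i, j ∈ s)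
    (h : ∀ i ∈ s, (Filter.generate (Y '' Iic i ∪ C)).NeBot) :
    (Filter.generate (Y '' s ∪ C)).NeBot := by
  rcases s.eq_empty_or_nonempty with rfl | hne
  · simpa using hC
  · have : Nonempty s := hne.to_subtype
    have heq : Y '' s ∪ C = ⋃ i : s, (Y '' Iic i.1 ∪ C) := by
      rw [← Set.iUnion_union, ← Set.image_iUnion]
      congr 2
      ext j
      simp only [Set.mem_iUnion, Set.mem_Iic, Subtype.exists, exists_prop]
      exact ⟨fun hj => ⟨j, hj, le_rfl⟩, fun ⟨i, hi, hji⟩ => hs i hi j hji⟩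
    rw [heq, Filter.generate_iUnion]
    refine Filter.iInf_neBot_of_directed' (fun i j => ⟨max i j, ?_, ?_⟩) fun i => h i i.2
    all_goals
      exact Filter.le_generate_iff.2 fun A hA => Filter.mem_generate_of_mem <|
        Set.union_subset_union_left _ (Set.image_mono (Set.Iic_subset_Iic.2 (by simp))) hA

/-- If no base of `U` has fewer than `κ` elements, then for any `κ` many functions `g i` there is a
nonprincipal ultrafilter whose image under each `g i` differs from `U`. -/
theorem exists_ultrafilter_forall_compl_preimage_mem (U : Ultrafilter ℕ) {κ : Cardinal.{0}}
    (hκ : Cardinal.aleph0 < κ) (hbase : ∀ S, IsUltrafilterBase S U → κ ≤ Cardinal.mk S)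
    (g : κ.ord.ToType → ℕ → ℕ) :
    ∃ V : Ultrafilter ℕ, (V : Filter ℕ) ≤ Filter.cofinite ∧
      ∀ i, ∃ B ∈ U, (g i ⁻¹' B)ᶜ ∈ V := by
  set C : Set (Set ℕ) := Set.range fun n : ℕ => {n}ᶜ
  have hC : (Filter.generate C).NeBot := by
    refine Filter.NeBot.mono (f := Filter.cofinite) inferInstance (Filter.le_generate_iff.2 ?_)
    rintro _ ⟨n, rfl⟩
    exact (Set.finite_singleton n).compl_mem_cofinite
  have hCinf : C.Infinite :=
    Set.infinite_range_of_injective fun m n h => by simpa using h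
  have hCcard : Cardinal.mk C ≤ Cardinal.aleph0 := Cardinal.mk_range_le.trans (by simp)
  obtain ⟨Y, hY⟩ := exists_forall_image_Iio (ι := κ.ord.ToType) (β := Set ℕ)
    (P := fun i T b => Cardinal.mk T < κ → (∃ B ∈ U, b = (g i ⁻¹' B)ᶜ) ∧
      ((Filter.generate (T ∪ C)).NeBot → (Filter.generate (T ∪ C) ⊓ Filter.principal b).NeBot)) <| by
    intro i T
    by_cases hT : Cardinal.mk T < κ
    swap
    · exact ⟨∅, fun h => absurd h hT⟩
    by_cases hne : (Filter.generate (T ∪ C)).NeBot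
    swap
    · exact ⟨_, fun _ => ⟨⟨Set.univ, Filter.univ_mem, rfl⟩, fun h => absurd h hne⟩⟩
    by_contra! hcon
    obtain ⟨S, hS, hST⟩ := exists_base_of_map_generate_le (hCinf.mono Set.subset_union_right)
      (T := T ∪ C) U (g i) (fun B hB => by
        have := ((hcon (g i ⁻¹' B)ᶜ).2 ⟨B, hB, rfl⟩).2
        rw [Filter.inf_principal_eq_bot, compl_compl] at this
        exact this)
    refine (hbase S hS).not_gt (hST.trans_lt ?_)
    exact (Cardinal.mk_union_le _ _).trans_lt
      (Cardinal.add_lt_of_lt hκ.le hT (hCcard.trans_lt hκ))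
  have hY' := fun i => hY i (Cardinal.mk_image_le.trans_lt (by
    simpa using Cardinal.mk_Iio_lt i (by simp)))
  have hne : ∀ i, (Filter.generate (Y '' Iic i ∪ C)).NeBot := by
    intro i
    induction i using WellFoundedLT.induction with
    | ind i ih =>
      have := (hY' i).2 (generate_image_union_neBot hC (fun j hj k hk => hk.trans_lt hj) ih)
      rwa [← Filter.generate_singleton, ← Filter.generate_union, Set.union_right_comm,
        ← Set.image_singleton, ← Set.image_union, Set.union_singleton, Set.Iio_insert] at this
  have := generate_image_union_neBot (s := Set.univ) hC (fun _ _ _ _ => trivial) fun i _ => hne i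
  refine ⟨Ultrafilter.of (Filter.generate (Y '' Set.univ ∪ C)), ?_, fun i => ?_⟩
  · rw [Filter.le_cofinite_iff_compl_singleton_mem]
    exact fun n => Ultrafilter.of_le _ (Filter.mem_generate_of_mem (Or.inr ⟨n, rfl⟩))
  · obtain ⟨⟨B, hB, hYB⟩, -⟩ := hY' i
    exact ⟨B, hB, hYB ▸ Ultrafilter.of_le _
      (Filter.mem_generate_of_mem (Or.inl ⟨i, trivial, rfl⟩))⟩

/-- The intersection of the dual ideals of two ultrafilters is not meager. -/
theorem not_isMeagre_cantorCopy_compl_mem_inter (U V : Ultrafilter ℕ) :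
    ¬ IsMeagre (cantorCopy {A | Aᶜ ∈ U ∧ Aᶜ ∈ V}) := by
  intro hJ
  set M := cantorCopy {A : Set ℕ | Aᶜ ∈ U ∧ Aᶜ ∈ V} with hM
  let τ : (ℕ → Bool) → (ℕ → Bool) → (ℕ → Bool) := fun d x n => xor (x n) (d n)
  have hτ : ∀ d, Function.Involutive (τ d) := fun d x => by ext n; simp [τ]
  have hc : ∀ d, Continuous (τ d) := fun d => continuous_pi fun n =>
    (continuous_of_discreteTopology (f := fun b => xor b (d n))).comp (continuous_apply n)
  have ho : ∀ d, IsOpenMap (τ d) := fun d =>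
    (Homeomorph.mk (hτ d).toPerm (hc d) (hc d)).isOpenMap
  have hpre : ∀ d, IsMeagre (τ d ⁻¹' M) := fun d => hJ.preimage_of_isOpenMap (hc d) (ho d)
  have hmem : ∀ x, x ∈ M ↔ {a | x a = true} ∉ U ∧ {a | x a = true} ∉ V := fun x => by
    simp [hM, cantorCopy, Ultrafilter.compl_mem_iff_notMem]
  have hxor : ∀ (W : Ultrafilter ℕ) x d, {a | τ d x a = true} ∈ W ↔
      ¬ ({a | x a = true} ∈ W ↔ {a | d a = true} ∈ W) := fun W x d => by
    have : ∀ p : ℕ → Prop, {a | p a} ∈ W ↔ ∀ᶠ a in (W : Filter ℕ), p a := fun p => Iff.rfl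
    simp only [this, τ]
    have hb : ∀ a, (xor (x a) (d a) = true) ↔
        (x a = true ∧ ¬ d a = true) ∨ (¬ x a = true ∧ d a = true) := fun a => by
      cases x a <;> cases d a <;> simp
    simp only [hb, Ultrafilter.eventually_or, Filter.eventually_and, Ultrafilter.eventually_not]
    tauto
  have htop : ∀ W : Ultrafilter ℕ, {_a : ℕ | True} ∈ W := fun W =>
    Filter.mem_of_superset Filter.univ_mem fun _ _ => trivial
  by_cases hd : ∃ d : ℕ → Bool, ¬ ({a | d a = true} ∈ U ↔ {a | d a = true} ∈ V)
  · obtain ⟨d, hd⟩ := hd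
    refine not_isMeagre_of_isOpen (isOpen_univ (X := ℕ → Bool)) Set.univ_nonempty <|
      (((hJ.union (hpre fun _ => true)).union (hpre d)).union
        ((hpre fun _ => true).preimage_of_isOpenMap (hc d) (ho d))).mono fun x _ => ?_
    simp only [Set.mem_union, Set.mem_preimage, hmem, hxor]
    have := htop U
    have := htop V
    tauto
  · push Not at hd
    refine not_isMeagre_of_isOpen (isOpen_univ (X := ℕ → Bool)) Set.univ_nonempty <|
      (hJ.union (hpre fun _ => true)).mono fun x _ => ?_
    simp only [Set.mem_union, Set.mem_preimage, hmem, hxor]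
    have := htop U
    have := htop V
    have := hd x
    tauto

/-- The dual ideal of an ultrafilter which is not a Q-point is Katětov-Blass above `EDfin`. -/
theorem katetovBlassLE_EDfin_of_forall_not_injOn (U : Ultrafilter ℕ)
    (hU : (U : Filter ℕ) ≤ Filter.cofinite) {p : ℕ → ℕ} (hp : FiniteToOne p)
    (hinj : ∀ A ∈ U, ¬ Set.InjOn p A) : KatetovBlassLE EDfin {A : Set ℕ | Aᶜ ∈ U} := by
  have hfib : ∀ n, ∃ m, ∀ k, p k = n → k ≤ m := fun n => (hp n).bddAbove
  choose m hm using hfib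
  let h : ℕ → Delta := fun n => ⟨(m (p n), n), hm _ _ rfl⟩
  have hh : Function.Injective h := fun a b hab =>
    congrArg (fun q : Delta => q.1.2) hab
  refine ⟨h, fun b => (Set.finite_singleton b).preimage hh.injOn, ?_⟩
  have hsmall : ∀ G ∈ EDGenerators, (fun n => (m (p n), n)) ⁻¹' G ∉ U := by
    rintro _ (⟨n, rfl⟩ | ⟨φ, rfl⟩) hmem
    · have hfin : ((fun k => (m (p k), k)) ⁻¹' {q : ℕ × ℕ | q.1 = n}).Finite :=
        (Set.finite_Iic n).subset fun k hk => (hm _ k rfl).trans (le_of_eq hk)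
      exact Ultrafilter.compl_notMem_iff.2 hmem (hU hfin.compl_mem_cofinite)
    · refine hinj _ hmem fun a ha b hb hab => ?_
      have ha' : a = φ (m (p a)) := ha
      have hb' : b = φ (m (p b)) := hb
      rw [ha', hb', hab]
  rintro A ⟨S, F, hS, hF, hAS⟩
  have hsub : h ⁻¹' A ⊆ (fun n => (m (p n), n)) ⁻¹' (F ∪ ⋃₀ ↑S) :=
    fun n hn => hAS ⟨h n, hn, rfl⟩
  refine Filter.mem_of_superset ?_ (Set.compl_subset_compl.2 hsub)
  rw [Ultrafilter.mem_coe, Ultrafilter.compl_mem_iff_notMem, Set.preimage_union,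
    Ultrafilter.union_mem_iff, not_or]
  constructor
  · rw [← Ultrafilter.compl_mem_iff_notMem]
    exact hU (hF.preimage (fun a _ b _ hab => congrArg Prod.snd hab)).compl_mem_cofinite
  · rw [Set.sUnion_eq_biUnion, Set.preimage_iUnion₂,
      Ultrafilter.finite_biUnion_mem_iff S.finite_toSet]
    rintro ⟨G, hG, hmem⟩
    exact hsmall G (hS hG) hmem

/-- A finite-to-one function is, up to an error of one, constant on the fibres of some
finite-to-one monotone function. -/
theorem exists_monotone_finiteToOne {f : ℕ → ℕ} (hf : FiniteToOne f) :
    ∃ p : ℕ → ℕ, FiniteToOne p ∧ Monotone p ∧ ∀ x y, f x = f y → p x ≤ p y + 1 := by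
  have hfib : ∀ n, ∃ m, ∀ k, f k = n → k ≤ m := fun n => (hf n).bddAbove
  choose m hm using hfib
  let g : ℕ → ℕ := fun x => x + 1 + ∑ y ∈ Finset.range (x + 1), m (f y)
  have hg : StrictMono g := strictMono_nat_of_lt_succ fun x => by
    simp only [g, Finset.sum_range_succ _ (x + 1)]
    omega
  have hgf : ∀ x y, f y = f x → y ≤ g x := fun x y hxy => by
    have := Finset.single_le_sum (f := fun y => m (f y)) (fun _ _ => Nat.zero_le _)
      (Finset.self_mem_range_succ x)
    have := hm _ _ hxy
    simp only [g]
    omega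
  have hlt : ∀ x, x < g x := fun x => by simp only [g]; omega
  have hiter : ∀ k, k ≤ g^[k] 0 := fun k => by
    induction k with
    | zero => simp
    | succ k ih =>
      rw [Function.iterate_succ_apply']
      exact Nat.succ_le_of_lt (ih.trans_lt (hlt _))
  have hex : ∀ x, ∃ k, x < g^[k] 0 := fun x => ⟨x + 1, hiter (x + 1)⟩
  refine ⟨fun x => Nat.find (hex x), fun k => ?_, fun x y hxy => ?_, fun x y hxy => ?_⟩
  · refine (Set.finite_Iio (g^[k] 0)).subset ?_
    rintro x rfl
    exact Nat.find_spec (hex x)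
  · exact Nat.find_min' _ (hxy.trans_lt (Nat.find_spec (hex y)))
  · refine Nat.find_min' _ ?_
    rw [Function.iterate_succ_apply']
    exact (hgf y x hxy).trans_lt (hg (Nat.find_spec (hex y)))

/-- A Q-point has a member on which the fibres of a given finite-to-one function are
well separated. -/
theorem exists_mem_forall_lt_of_qpoint (U : Ultrafilter ℕ)
    (hQ : ∀ p : ℕ → ℕ, FiniteToOne p → ∃ A ∈ U, Set.InjOn p A) {f : ℕ → ℕ} (hf : FiniteToOne f) :
    ∃ A ∈ U, ∀ a ∈ A, ∀ b ∈ A, a < b → ∀ n, (f n = f a → n < b) ∧ (f n = f b → a < n) := by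
  obtain ⟨p, hp, hmono, hpf⟩ := exists_monotone_finiteToOne hf
  have hfin : ∀ c, FiniteToOne fun n => (p n + c) / 2 := fun c k =>
    ((Set.finite_Iio (2 * k + 2)).preimage' fun b _ => hp b).subset fun n hn => by
      simp only [Set.mem_preimage, Set.mem_singleton_iff, Set.mem_Iio] at hn ⊢
      omega
  obtain ⟨A₀, hA₀, h₀⟩ := hQ _ (hfin 0)
  obtain ⟨A₁, hA₁, h₁⟩ := hQ _ (hfin 1)
  refine ⟨A₀ ∩ A₁, Filter.inter_mem hA₀ hA₁, fun a ha b hb hab n => ?_⟩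
  have e₀ : (p a + 0) / 2 ≠ (p b + 0) / 2 := fun h => hab.ne (h₀ ha.1 hb.1 h)
  have e₁ : (p a + 1) / 2 ≠ (p b + 1) / 2 := fun h => hab.ne (h₁ ha.2 hb.2 h)
  have := hmono hab.le
  constructor
  · intro h
    by_contra! hle
    have := hmono hle
    have := hpf n a h
    omega
  · intro h
    by_contra! hle
    have := hmono hle
    have := hpf b n h.symm
    omega

/-- The nearest elements of `A` above (for `true`) and below (for `false`) a number. -/
noncomputable def neighbourIn (A : Set ℕ) (above : Bool) (n : ℕ) : ℕ :=
  if above then sInf {a | a ∈ A ∧ n ≤ a} else sSup {a | a ∈ A ∧ a ≤ n}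

theorem exists_neighbourIn_eq {A : Set ℕ} {f : ℕ → ℕ}
    (hA : ∀ a ∈ A, ∀ b ∈ A, a < b → ∀ n, (f n = f a → n < b) ∧ (f n = f b → a < n))
    {a n : ℕ} (ha : a ∈ A) (hn : f n = f a) : ∃ above, neighbourIn A above n = a := by
  rcases le_or_gt n a with h | h
  · refine ⟨true, IsLeast.csInf_eq ⟨⟨ha, h⟩, fun b hb => ?_⟩⟩
    by_contra! hba
    exact absurd ((hA b hb.1 a ha hba n).2 hn) hb.2.not_gt
  · refine ⟨false, IsGreatest.csSup_eq ⟨⟨ha, h.le⟩, fun b hb => ?_⟩⟩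
    by_contra! hab
    exact absurd ((hA a ha b hb.1 hab n).1 hn) hb.2.not_gt

/-- For every Q-point `U` there is a nonprincipal ultrafilter which is not nearly coherent
to `U`. -/
theorem exists_ultrafilter_forall_map_ne_of_qpoint (U : Ultrafilter ℕ)
    (hU : (U : Filter ℕ) ≤ Filter.cofinite)
    (hQ : ∀ p : ℕ → ℕ, FiniteToOne p → ∃ A ∈ U, Set.InjOn p A) :
    ∃ V : Ultrafilter ℕ, (V : Filter ℕ) ≤ Filter.cofinite ∧
      ∀ f : ℕ → ℕ, FiniteToOne f → V.map f ≠ U.map f := by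
  obtain ⟨S, hS, hmin⟩ := exists_minimalFor_of_wellFoundedLT (fun S => IsUltrafilterBase S U)
    (fun S => Cardinal.mk S) ⟨{A | A ∈ U}, le_rfl, fun A hA => ⟨A, hA, le_rfl⟩⟩
  have hcard := hS.aleph0_lt hU
  obtain ⟨e⟩ : Nonempty ((Cardinal.mk S).ord.ToType ≃ S × Bool) := by
    refine Cardinal.eq.1 ?_
    rw [Cardinal.mk_ord_toType, Cardinal.mk_prod]
    simpa using (Cardinal.mul_eq_left hcard.le
      ((Cardinal.natCast_lt_aleph0 (n := 2)).le.trans hcard.le) (by simp)).symm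
  obtain ⟨V, hV, hVg⟩ := exists_ultrafilter_forall_compl_preimage_mem U hcard
    (fun T hT => (le_total _ _).elim (fun h => hmin hT h) id)
    (fun i => neighbourIn (e i).1 (e i).2)
  refine ⟨V, hV, fun f hf heq => ?_⟩
  obtain ⟨A₀, hA₀, hsep⟩ := exists_mem_forall_lt_of_qpoint U hQ hf
  obtain ⟨A, hAS, hA⟩ := hS.2 A₀ hA₀
  have hVg' : ∀ above, ∃ B ∈ U, (neighbourIn A above ⁻¹' B)ᶜ ∈ V := fun above => by
    simpa using hVg (e.symm (⟨A, hAS⟩, above))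
  choose B hB hBV using hVg'
  have hBU : B true ∩ B false ∩ A ∈ U :=
    Filter.inter_mem (Filter.inter_mem (hB true) (hB false)) (hS.1 hAS)
  have himage : f ⁻¹' (f '' (B true ∩ B false ∩ A)) ∈ V := by
    rw [← Ultrafilter.mem_map, heq, Ultrafilter.mem_map]
    exact Filter.mem_of_superset hBU (Set.subset_preimage_image f _)
  obtain ⟨n, ⟨ht, hf'⟩, a, ha, han⟩ := V.nonempty_of_mem
    (Filter.inter_mem (Filter.inter_mem (hBV true) (hBV false)) himage)
  obtain ⟨above, hab⟩ := exists_neighbourIn_eq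
    (fun a ha b hb => hsep a (hA ha) b (hA hb)) ha.2 han.symm
  cases above
  · exact hf' (by rw [Set.mem_preimage, hab]; exact ha.1.2)
  · exact ht (by rw [Set.mem_preimage, hab]; exact ha.1.1)

/-- The ultrafilter given by a family satisfying `IsUltrafilterSet`. -/
theorem IsUltrafilterSet.exists_ultrafilter {U : Set (Set ℕ)} (hU : IsUltrafilterSet U) :
    ∃ W : Ultrafilter ℕ, ∀ A, A ∈ W ↔ A ∈ U := by
  obtain ⟨huniv, hempty, hup, hinter, hor⟩ := hU
  let F : Filter ℕ :=
    { sets := U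
      univ_sets := huniv
      sets_of_superset := hup _ _
      inter_sets := hinter _ _ }
  refine ⟨Ultrafilter.ofComplNotMemIff F fun A => ⟨fun h => ?_, fun h h' => ?_⟩, fun A => Iff.rfl⟩
  · exact (hor A).resolve_right fun h' => h (by rwa [← Set.compl_eq_univ_sdiff] at h')
  · exact hempty (by simpa using hinter _ _ h h')

theorem NonprincipalUF.le_cofinite {U : Set (Set ℕ)} (hU : NonprincipalUF U) {W : Ultrafilter ℕ}
    (hW : ∀ A, A ∈ W ↔ A ∈ U) : (W : Filter ℕ) ≤ Filter.cofinite := by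
  intro A hA
  by_contra h
  exact hU _ hA ((hW _).1 (Ultrafilter.compl_mem_iff_notMem.2 h))

/-- The intersection of the dual ideals of two nonprincipal ultrafilters is an ideal. -/
theorem isIdeal_compl_mem_inter {U V : Ultrafilter ℕ} (hU : (U : Filter ℕ) ≤ Filter.cofinite)
    (hV : (V : Filter ℕ) ≤ Filter.cofinite) : IsIdeal {A : Set ℕ | Aᶜ ∈ U ∧ Aᶜ ∈ V} := by
  refine ⟨fun A hA => ⟨hU hA.compl_mem_cofinite, hV hA.compl_mem_cofinite⟩, by simp,
    fun A B hA hBA => ?_, fun A B hA hB => ?_⟩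
  · have := Set.compl_subset_compl.2 hBA
    exact ⟨Filter.mem_of_superset hA.1 this, Filter.mem_of_superset hA.2 this⟩
  · simp only [Set.mem_ofPred_eq, Set.compl_union]
    exact ⟨Filter.inter_mem hA.1 hB.1, Filter.inter_mem hA.2 hB.2⟩

/-- the Filter Dichotomy implies every non-meager ideal is
Katětov-Blass above `ED_fin`. -/
theorem stmt8
    (FD : ∀ I : Set (Set ℕ), IsIdeal I →
      IsMeagre (cantorCopy I) ∨
        ∃ U : Set (Set ℕ), IsUltrafilterSet U ∧ NonprincipalUF U ∧
          ∃ f : ℕ → ℕ, FiniteToOne f ∧ ∀ A : Set ℕ, A ∈ dualIdeal U ↔ f ⁻¹' A ∈ I)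
    (I : Set (Set ℕ)) (hI : IsIdeal I) (hnm : ¬ IsMeagre (cantorCopy I)) :
    KatetovBlassLE EDfin I := by
  obtain ⟨U, hU, hUn, f, hf, hfI⟩ := (FD I hI).resolve_left hnm
  obtain ⟨W, hW⟩ := hU.exists_ultrafilter
  have hWc := hUn.le_cofinite hW
  suffices h : KatetovBlassLE EDfin {A : Set ℕ | Aᶜ ∈ W} by
    obtain ⟨g, hg, hgE⟩ := h
    refine ⟨g ∘ f, fun b => ?_, fun A hA => (hfI (g ⁻¹' A)).1 ?_⟩
    · exact (hg b).preimage' fun n _ => hf n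
    · have := (hW _).1 (hgE A hA)
      rwa [Set.compl_eq_univ_sdiff] at this
  by_contra hE
  have hQ : ∀ p : ℕ → ℕ, FiniteToOne p → ∃ A ∈ W, Set.InjOn p A := by
    intro p hp
    by_contra! hinj
    exact hE (katetovBlassLE_EDfin_of_forall_not_injOn W hWc hp hinj)
  obtain ⟨V, hVc, hV⟩ := exists_ultrafilter_forall_map_ne_of_qpoint W hWc hQ
  obtain ⟨U', hU', -, h, hh, hhJ⟩ := (FD _ (isIdeal_compl_mem_inter hWc hVc)).resolve_left
    (not_isMeagre_cantorCopy_compl_mem_inter W V)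
  obtain ⟨X, hX⟩ := hU'.exists_ultrafilter
  have hsub : ∀ A ∈ X, h ⁻¹' A ∈ W ∧ h ⁻¹' A ∈ V := fun A hA => by
    have := (hhJ Aᶜ).1 (by
      rw [dualIdeal, Set.mem_ofPred_eq, ← Set.compl_eq_univ_sdiff, compl_compl]
      exact (hX A).1 hA)
    simpa using this
  have hXW : X = W.map h := (Ultrafilter.coe_le_coe.1 fun A hA => (hsub A hA).1).symm
  have hXV : X = V.map h := (Ultrafilter.coe_le_coe.1 fun A hA => (hsub A hA).2).symm
  exact hV h hh (hXV.symm.trans hXW)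
end

section
/- Let I be a non-meager ideal on ω. Then the Category Dichotomy holds for I (that is, I ≤_K nwd or there exists X ∈ I⁺ with ED ≤_K I↾X) if and only if there exists X ∈ I⁺ with ED ≤_K I↾X. Equivalently, a non-meager ideal on ω is never Katětov below nwd. -/
open Cardinal Set

/-- The subsets of `α` missing a fixed infinite set form a nowhere dense set. -/
theorem isNowhereDense_forall_eq_false {α : Type*} {F : Set α} (hF : F.Infinite) :
    IsNowhereDense {x : α → Bool | ∀ a ∈ F, x a = false} := by
  classical
  have hclosed : IsClosed {x : α → Bool | ∀ a ∈ F, x a = false} := by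
    simp only [ofPred_forall]
    exact isClosed_biInter fun a _ => isClosed_eq (continuous_apply a) continuous_const
  rw [hclosed.isNowhereDense_iff, eq_empty_iff_forall_notMem]
  intro x hx
  obtain ⟨s, u, hu, hsub⟩ := isOpen_pi_iff.1 isOpen_interior x hx
  obtain ⟨a, haF, has⟩ := hF.exists_notMem_finset s
  have hmem : Function.update x a true ∈ (s : Set α).pi u := by
    intro b hb
    rw [Function.update_of_ne (ne_of_mem_of_not_mem hb has)]
    exact (hu b hb).2
  simpa using interior_subset (hsub hmem) a haF

/-- An ideal that is Katětov below `nwd` is meager. -/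
theorem isMeagre_cantorCopy_of_katetovLE_nwdQ {α : Type*} {I : Set (Set α)} (hI : IsIdeal I)
    (h : KatetovLE I nwdQ) : IsMeagre (cantorCopy I) := by
  obtain ⟨f, hf⟩ := h
  let B := TopologicalSpace.countableBasis ℚ
  have hB : TopologicalSpace.IsTopologicalBasis B := TopologicalSpace.isBasis_countableBasis ℚ
  have himage : ∀ U ∈ B, (f '' U).Infinite := by
    intro U hU hfin
    have hnwd : IsNowhereDense U := (hf _ (hI.1 _ hfin)).mono (subset_preimage_image f U)
    have hsub : U ⊆ interior (closure U) := (hB.isOpen hU).subset_interior_iff.2 subset_closure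
    rw [hnwd] at hsub
    exact (TopologicalSpace.nonempty_of_mem_countableBasis hU).ne_empty (subset_empty_iff.1 hsub)
  have hmeagre : IsMeagre (⋃ U ∈ B, {x : α → Bool | ∀ a ∈ f '' U, x a = false}) :=
    isMeagre_biUnion (TopologicalSpace.countable_countableBasis ℚ) fun U hU =>
      (isNowhereDense_forall_eq_false (himage U hU)).isMeagre
  refine hmeagre.mono fun x hx => ?_
  have hnwd : IsNowhereDense (f ⁻¹' {a | x a = true}) := hf _ hx
  obtain ⟨q, hq⟩ : (closure (f ⁻¹' {a | x a = true}))ᶜ.Nonempty := by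
    rw [nonempty_compl]
    intro huniv
    rw [IsNowhereDense, huniv, interior_univ] at hnwd
    exact univ_nonempty.ne_empty hnwd
  obtain ⟨U, hU, -, hsub⟩ := hB.exists_subset_of_mem_open hq isClosed_closure.isOpen_compl
  refine mem_biUnion hU ?_
  rintro _ ⟨r, hr, rfl⟩
  by_contra hne
  exact hsub hr (subset_closure (Bool.eq_true_of_not_eq_false hne))

/-- for a non-meager ideal, the Category Dichotomy is equivalent to
having a restriction above `ED`; equivalently, a non-meager ideal is never below `nwd`. -/
theorem stmt9 (I : Set (Set ℕ)) (hI : IsIdeal I) (hnm : ¬ IsMeagre (cantorCopy I)) :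
    ((KatetovLE I nwdQ ∨ ∃ X : Set ℕ, X ∉ I ∧ KatetovLE ED (restrictIdeal I X)) ↔
        ∃ X : Set ℕ, X ∉ I ∧ KatetovLE ED (restrictIdeal I X)) ∧
      ¬ KatetovLE I nwdQ := by
  have h : ¬ KatetovLE I nwdQ := fun hK => hnm (isMeagre_cantorCopy_of_katetovLE_nwdQ hI hK)
  exact ⟨or_iff_right h, h⟩
end

section
/- Let X be a zero-dimensional topological space with uncountable π-character everywhere. Then for every sequence (U_n : n ∈ ω) of nonempty open subsets of X there is a sequence (C_n : n ∈ ω) of pairwise disjoint nonempty clopen sets with C_n ⊆ U_n for every n. -/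
open Cardinal Set

/-- In a zero-dimensional space with uncountable π-character everywhere, a nonempty open set
contains a nonempty clopen set that covers no member of a given sequence of nonempty open sets. -/
theorem exists_isClopen_subset_forall_diff_nonempty {α : Type*} [TopologicalSpace α]
    (hz : ZeroDimensional α) (hπ : UncountablePiCharEverywhere α) {W : Set α}
    (hW : IsOpen W) (hne : W.Nonempty) (U : ℕ → Set α)
    (hU : ∀ n, IsOpen (U n) ∧ (U n).Nonempty) :
    ∃ C ⊆ W, IsClopen C ∧ C.Nonempty ∧ ∀ n, (U n \ C).Nonempty := by
  obtain ⟨b, hb⟩ := hne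
  have hloc : ¬ IsLocalPiBase (Set.range U) b := fun h => hπ b _ h (Set.countable_range U)
  have hV : ∃ V : Set α, IsOpen V ∧ b ∈ V ∧ ∀ n, ¬ U n ⊆ V := by
    by_contra! h
    refine hloc ⟨Set.forall_mem_range.2 hU, fun V hVo hbV => ?_⟩
    obtain ⟨n, hn⟩ := h V hVo hbV
    exact ⟨U n, Set.mem_range_self n, hn⟩
  obtain ⟨V, hVo, hbV, hUV⟩ := hV
  obtain ⟨C, hC, hbC, hCWV⟩ := hz.exists_subset_of_mem_open
    (show b ∈ W ∩ V from ⟨hb, hbV⟩) (hW.inter hVo)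
  refine ⟨C, hCWV.trans Set.inter_subset_left, hC, ⟨b, hbC⟩, fun n => ?_⟩
  exact Set.sdiff_nonempty.2 fun h => hUV n (h.trans (hCWV.trans Set.inter_subset_right))

/-- topological disjoint refinement lemma. -/
theorem stmt11 {α : Type*} [TopologicalSpace α]
    (hz : ZeroDimensional α) (hπ : UncountablePiCharEverywhere α)
    (U : ℕ → Set α) (hU : ∀ n, IsOpen (U n) ∧ (U n).Nonempty) :
    ∃ C : ℕ → Set α, (∀ n, IsClopen (C n) ∧ (C n).Nonempty ∧ C n ⊆ U n) ∧
      Pairwise (Function.onFun Disjoint C) := by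
  have step : ∀ (D : {D : Set α // IsClopen D ∧ ∀ m, (U m \ D).Nonempty}) (n : ℕ),
      ∃ D' : {D : Set α // IsClopen D ∧ ∀ m, (U m \ D).Nonempty},
        D.1 ⊆ D'.1 ∧ (D'.1 \ D.1).Nonempty ∧ D'.1 \ D.1 ⊆ U n := by
    rintro ⟨D, hD, hUD⟩ n
    have hopen : ∀ m, IsOpen (U m \ D) := fun m => (hU m).1.sdiff hD.isClosed
    obtain ⟨C, hCU, hC, ⟨c, hc⟩, hdiff⟩ := exists_isClopen_subset_forall_diff_nonempty hz hπ
      (hopen n) (hUD n) (fun m => U m \ D) (fun m => ⟨hopen m, hUD m⟩)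
    refine ⟨⟨D ∪ C, hD.union hC, fun m => ?_⟩, Set.subset_union_left,
      ⟨c, Or.inr hc, (hCU hc).2⟩, ?_⟩
    · rw [← Set.sdiff_sdiff]
      exact hdiff m
    · rintro x ⟨hx | hx, hxD⟩
      · exact absurd hx hxD
      · exact (hCU hx).1
  choose next hsub hne hnext using step
  let D : ℕ → {D : Set α // IsClopen D ∧ ∀ m, (U m \ D).Nonempty} := fun n =>
    Nat.rec ⟨∅, isClopen_empty, fun m => by simpa using (hU m).2⟩ (fun k E => next E k) n
  have hmono : Monotone fun n => (D n).1 := monotone_nat_of_le_succ fun n => hsub (D n) n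
  refine ⟨fun n => (D (n + 1)).1 \ (D n).1, fun n =>
    ⟨(D (n + 1)).2.1.diff (D n).2.1, hne (D n) n, hnext (D n) n⟩, ?_⟩
  refine (pairwise_disjoint_on _).2 fun m n hmn => Set.disjoint_left.2 fun x hx hx' => ?_
  exact hx'.2 (hmono (Nat.succ_le_of_lt hmn) hx.1)
end

section
/- Let X be a countably infinite zero-dimensional topological space with uncountable π-character everywhere. Then the collection nwd(X) of nowhere dense subsets of X is tight: for every countable family {Y_n : n ∈ ω} of subsets of X none of which is nowhere dense, there is a nowhere dense set D ⊆ X such that D ∩ Y_n is infinite for every n. -/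
open Cardinal Set

/-- In a zero-dimensional space with uncountable π-character everywhere, singletons are
nowhere dense. -/
theorem isNowhereDense_singleton_of_uncountablePiChar {α : Type*} [TopologicalSpace α]
    (hz : ZeroDimensional α) (hπ : UncountablePiCharEverywhere α) (x : α) :
    IsNowhereDense ({x} : Set α) := by
  by_contra hne
  obtain ⟨y, hy⟩ := nonempty_iff_ne_empty.mpr hne
  obtain ⟨V, hV, hyV, hVsub⟩ := hz.exists_subset_of_mem_open hy isOpen_interior
  have mem_of_open : ∀ W : Set α, IsOpen W → W ⊆ V → W.Nonempty → x ∈ W := by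
    rintro W hW hWV ⟨z, hz⟩
    obtain ⟨w, hwW, rfl⟩ :=
      mem_closure_iff.mp (interior_subset (hVsub (hWV hz))) W hW hz
    exact hwW
  have hxV : x ∈ V := mem_of_open V hV.isOpen subset_rfl ⟨y, hyV⟩
  refine hπ x {V} ⟨?_, fun W hW hxW => ⟨V, rfl, ?_⟩⟩ (countable_singleton V)
  · rintro _ rfl
    exact ⟨hV.isOpen, y, hyV⟩
  · obtain ⟨C, hC, hxC, hCW⟩ := hz.exists_subset_of_mem_open hxW hW
    by_contra hVW
    obtain ⟨z, hzV, hzW⟩ := not_subset.mp hVW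
    exact (mem_of_open (V \ C) (hV.isOpen.sdiff hC.isClosed) sdiff_subset
      ⟨z, hzV, fun h => hzW (hCW h)⟩).2 hxC

theorem isNowhereDense_of_finite_of_uncountablePiChar {α : Type*} [TopologicalSpace α]
    (hz : ZeroDimensional α) (hπ : UncountablePiCharEverywhere α) {F : Set α} (hF : F.Finite) :
    IsNowhereDense F := by
  induction F, hF using Set.Finite.induction_on with
  | empty => exact isNowhereDense_empty
  | @insert a s _ _ ih =>
    have ha := isNowhereDense_singleton_of_uncountablePiChar hz hπ a
    rw [IsNowhereDense, insert_eq, closure_union,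
      interior_union_isClosed_of_interior_empty isClosed_closure ih]
    exact ha

/-- A set which is locally finite in a space whose finite sets are nowhere dense is itself
nowhere dense. -/
theorem isNowhereDense_of_locally_finite {α : Type*} [TopologicalSpace α]
    (hfin : ∀ F : Set α, F.Finite → IsNowhereDense F) {D : Set α}
    (hD : ∀ x, ∃ V, IsOpen V ∧ x ∈ V ∧ (D ∩ V).Finite) : IsNowhereDense D := by
  refine eq_empty_iff_forall_notMem.mpr fun x hx => ?_
  obtain ⟨V, hVo, hxV, hVD⟩ := hD x
  have hsub : interior (closure D) ∩ V ⊆ interior (closure (D ∩ V)) := by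
    refine interior_maximal ?_ (isOpen_interior.inter hVo)
    rintro y ⟨hy, hyV⟩
    exact hVo.closure_inter ⟨interior_subset hy, hyV⟩
  have hempty : interior (closure (D ∩ V)) = ∅ := hfin _ hVD
  exact (hempty ▸ hsub ⟨hx, hxV⟩ : x ∈ (∅ : Set α))

/-- A clopen set containing no member of a countable family of open sets can be enlarged to
one which also contains a given point. -/
theorem exists_isClopen_insert_not_subset {α ι : Type*} [TopologicalSpace α] [Countable ι]
    (hz : ZeroDimensional α) (hπ : UncountablePiCharEverywhere α) {U : ι → Set α}
    (hU : ∀ i, IsOpen (U i)) {A : Set α} (hA : IsClopen A) (hUA : ∀ i, ¬ U i ⊆ A) (x : α) :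
    ∃ A', IsClopen A' ∧ (∀ i, ¬ U i ⊆ A') ∧ A ⊆ A' ∧ x ∈ A' := by
  have hB := mt (hπ x (range fun i => U i \ A)) (not_not_intro (countable_range _))
  have : ∃ W, IsOpen W ∧ x ∈ W ∧ ∀ i, ¬ U i \ A ⊆ W := by
    by_contra! h
    refine hB ⟨?_, fun W hW hxW => ?_⟩
    · rintro _ ⟨i, rfl⟩
      exact ⟨(hU i).sdiff hA.isClosed, nonempty_of_not_subset (hUA i)⟩
    · obtain ⟨i, hi⟩ := h W hW hxW
      exact ⟨_, ⟨i, rfl⟩, hi⟩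
  obtain ⟨W, hW, hxW, hUW⟩ := this
  obtain ⟨C, hC, hxC, hCW⟩ := hz.exists_subset_of_mem_open hxW hW
  refine ⟨A ∪ C, hA.union hC, fun i hi => hUW i ?_, subset_union_left, Or.inr hxC⟩
  exact (sdiff_subset_iff.mpr hi).trans hCW

/-- the nowhere dense ideal of a countably infinite zero-dimensional
space with uncountable π-character everywhere is tight. -/
theorem stmt12 {α : Type} [TopologicalSpace α] [Countable α] [Infinite α]
    (hz : ZeroDimensional α) (hπ : UncountablePiCharEverywhere α)
    (Y : ℕ → Set α) (hY : ∀ n, ¬ IsNowhereDense (Y n)) :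
    ∃ D : Set α, IsNowhereDense D ∧ ∀ n, (D ∩ Y n).Infinite := by
  obtain ⟨e, he⟩ := exists_surjective_nat α
  let U : ℕ → Set α := fun n => interior (closure (Y n))
  let S := {A : Set α // IsClopen A ∧ ∀ n, ¬ U n ⊆ A}
  have hstep : ∀ (x : α) (A : S), ∃ A' : S, A.1 ⊆ A'.1 ∧ x ∈ A'.1 := fun x A => by
    obtain ⟨A', h, h', h''⟩ := exists_isClopen_insert_not_subset hz hπ
      (fun n => (isOpen_interior : IsOpen (U n))) A.2.1 A.2.2 x
    exact ⟨⟨A', h, h'⟩, h''⟩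
  choose f hfsub hfmem using hstep
  let A : ℕ → S := fun k => Nat.rec
    ⟨∅, isClopen_empty, fun n h => hY n (subset_empty_iff.mp h)⟩ (fun k A => f (e k) A) k
  have hmono : Monotone fun k => (A k).1 := monotone_nat_of_le_succ fun k => hfsub (e k) (A k)
  have hmem : ∀ x, ∃ k, x ∈ (A k).1 := fun x => by
    obtain ⟨k, rfl⟩ := he x
    exact ⟨k + 1, hfmem (e k) (A k)⟩
  have hpick : ∀ j : ℕ, ∃ d, d ∈ Y j.unpair.1 ∧ d ∉ (A j).1 := fun j => by
    obtain ⟨z, hzU, hzA⟩ := not_subset.mp ((A j).2.2 j.unpair.1)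
    obtain ⟨d, hdA, hdY⟩ := mem_closure_iff.mp (interior_subset hzU) _
      (A j).2.1.compl.isOpen hzA
    exact ⟨d, hdY, hdA⟩
  choose d hdY hdA using hpick
  refine ⟨range d, ?_, fun n hfin => ?_⟩
  · refine isNowhereDense_of_locally_finite
      (fun F => isNowhereDense_of_finite_of_uncountablePiChar hz hπ) fun x => ?_
    obtain ⟨k, hk⟩ := hmem x
    refine ⟨(A k).1, (A k).2.1.isOpen, hk, ((finite_Iio k).image d).subset ?_⟩
    rintro _ ⟨⟨j, rfl⟩, hj⟩
    exact ⟨j, not_le.mp fun h => hdA j (hmono h hj), rfl⟩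
  · obtain ⟨k, hk⟩ := hmono.directed_le.exists_mem_subset_of_finset_subset_biUnion
      (s := hfin.toFinset) fun x _ => mem_iUnion.mpr (hmem x)
    rw [hfin.coe_toFinset] at hk
    have hYd : d (Nat.pair n k) ∈ Y n := by simpa using hdY (Nat.pair n k)
    exact hdA _ (hmono (Nat.right_le_pair n k) (hk ⟨mem_range_self _, hYd⟩))
end
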